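/- Let A be a complex Banach algebra with associative product satisfying ‖ab‖ ≤ C₀‖a‖‖b‖, and let (α_x)_{x∈ℝ^n} be a smooth polynomially bounded ℝ^n-action of order m ≥ 0 on A by continuous algebra automorphisms. Fix the pairing ⟨p,x⟩ := ⟪p, Mx⟫ with M invertible, |det M| = 1, and let θ be a real n×n matrix. Then: (i) for all a, b ∈ A, the function (p,x) ↦ α_{θp}(a) α_x(b) belongs to S^{2m,0}(ℝ^{2n}, A), so its oscillatory integral a ×_θ b := I((p,x) ↦ α_{θp}(a)α_x(b)) exists; (ii) the map (a,b) ↦ a ×_θ b is bilinear and continuous, i.e. there is C > 0 with ‖a ×_θ b‖ ≤ C‖a‖‖b‖; and (iii) ×_θ is associative: (a ×_θ b) ×_θ c = a ×_θ (b ×_θ c) for all a, b, c ∈ A. -/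

import Mathlib

open Filter MeasureTheory

noncomputable def pder {n : ℕ} {V : Type*} [NormedAddCommGroup V] [NormedSpace ℝ V]
    (i : Fin n) (f : (Fin n → ℝ) → V) : (Fin n → ℝ) → V :=
  fun x => fderiv ℝ f x (Pi.single i 1)

noncomputable def mder {n : ℕ} {V : Type*} [NormedAddCommGroup V] [NormedSpace ℝ V]
    (μ : Fin n → ℕ) (f : (Fin n → ℝ) → V) : (Fin n → ℝ) → V :=
  (List.finRange n).foldr (fun i g => (pder i)^[μ i] g) f

def mOrder {n : ℕ} (μ : Fin n → ℕ) : ℕ := ∑ i, μ i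

noncomputable def symWt {n : ℕ} (m ρ : ℝ) (μ : Fin n → ℕ) (x : Fin n → ℝ) : ℝ :=
  (1 + ‖x‖ ^ 2) ^ (-(m - ρ * (mOrder μ : ℝ)) / 2)

noncomputable def symNorm {n : ℕ} {V : Type*} [NormedAddCommGroup V] [NormedSpace ℝ V]
    (m ρ : ℝ) (μ : Fin n → ℕ) (F : (Fin n → ℝ) → V) : ℝ :=
  ⨆ x : Fin n → ℝ, symWt m ρ μ x * ‖mder μ F x‖

def IsSymbol {n : ℕ} {V : Type*} [NormedAddCommGroup V] [NormedSpace ℝ V]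
    (m ρ : ℝ) (F : (Fin n → ℝ) → V) : Prop :=
  ContDiff ℝ (⊤ : ℕ∞) F ∧ ∀ μ : Fin n → ℕ, ∃ C : ℝ, ∀ x, symWt m ρ μ x * ‖mder μ F x‖ ≤ C
def fstHalf {n : ℕ} (z : Fin (n + n) → ℝ) : Fin n → ℝ := fun i => z (Fin.castAdd n i)

def sndHalf {n : ℕ} (z : Fin (n + n) → ℝ) : Fin n → ℝ := fun i => z (Fin.natAdd n i)

noncomputable def pairM {n : ℕ} (M : Matrix (Fin n) (Fin n) ℝ) (p x : Fin n → ℝ) : ℝ :=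
  ∑ i, p i * M.mulVec x i

noncomputable def phase {n : ℕ} (M : Matrix (Fin n) (Fin n) ℝ) (z : Fin (n + n) → ℝ) : ℂ :=
  Complex.exp (Complex.I * (pairM M (fstHalf z) (sndHalf z) : ℂ))

noncomputable def cutInt {n : ℕ} {V : Type*} [NormedAddCommGroup V] [NormedSpace ℝ V]
    [NormedSpace ℂ V] [IsScalarTower ℝ ℂ V] (M : Matrix (Fin n) (Fin n) ℝ)
    (χ : (Fin (n + n) → ℝ) → ℝ) (z₀ : Fin (n + n) → ℝ) (ε : ℝ)
    (F : (Fin (n + n) → ℝ) → V) : V :=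
  ((2 * Real.pi) ^ n)⁻¹ • ∫ z : Fin (n + n) → ℝ, χ (ε • (z - z₀)) • (phase M z • F z)

def IsOscInt {n : ℕ} {V : Type*} [NormedAddCommGroup V] [NormedSpace ℝ V]
    [NormedSpace ℂ V] [IsScalarTower ℝ ℂ V] (M : Matrix (Fin n) (Fin n) ℝ)
    (F : (Fin (n + n) → ℝ) → V) (v : V) : Prop :=
  ∀ χ : (Fin (n + n) → ℝ) → ℝ, ContDiff ℝ (⊤ : ℕ∞) χ → HasCompactSupport χ →
    (∀ᶠ z in nhds (0 : Fin (n + n) → ℝ), χ z = 1) →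
    ∀ z₀ : Fin (n + n) → ℝ,
      Filter.Tendsto (fun ε : ℝ => cutInt M χ z₀ ε F) (nhdsWithin 0 (Set.Ioi 0)) (nhds v)

open Classical in
noncomputable def oscInt {n : ℕ} {V : Type*} [NormedAddCommGroup V] [NormedSpace ℝ V]
    [NormedSpace ℂ V] [IsScalarTower ℝ ℂ V] (M : Matrix (Fin n) (Fin n) ℝ)
    (F : (Fin (n + n) → ℝ) → V) : V :=
  if h : ∃ v, IsOscInt M F v then h.choose else 0

noncomputable def defProd {n : ℕ} {A : Type*} [NormedAddCommGroup A] [NormedSpace ℝ A]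
    [NormedSpace ℂ A] [IsScalarTower ℝ ℂ A]
    (M θ : Matrix (Fin n) (Fin n) ℝ) (mul : A →L[ℂ] A →L[ℂ] A)
    (α : (Fin n → ℝ) → A →L[ℂ] A) (a b : A) : A :=
  oscInt M (fun z : Fin (n + n) → ℝ =>
    mul (α (θ.mulVec (fstHalf z)) a) (α (sndHalf z) b))

open scoped ContDiff

section Scalar

/-- Fourier inversion at the origin, with the dot product on `Fin n → ℝ`. -/
theorem integral_integral_cexp_dotProduct {n : ℕ} (g : (Fin n → ℝ) → ℂ) (hc : Continuous g)
    (hi : Integrable g)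
    (hF : Integrable fun u : Fin n → ℝ => ∫ y, g y * Complex.exp (Complex.I * (u ⬝ᵥ y : ℝ))) :
    ∫ u : Fin n → ℝ, ∫ y, g y * Complex.exp (Complex.I * (u ⬝ᵥ y : ℝ)) =
      (2 * Real.pi) ^ n * g 0 := by
  set Φ : (Fin n → ℝ) → ℂ := fun u => ∫ y, g y * Complex.exp (Complex.I * (u ⬝ᵥ y : ℝ)) with hΦ
  have mp := EuclideanSpace.volume_preserving_symm_measurableEquiv_toLp (Fin n)
  have me := (MeasurableEquiv.toLp 2 (Fin n → ℝ)).symm.measurableEmbedding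
  set G : EuclideanSpace ℝ (Fin n) → ℂ := fun v => g ((MeasurableEquiv.toLp 2 (Fin n → ℝ)).symm v)
    with hG
  have hGc : Continuous G := hc.comp (PiLp.continuous_ofLp 2 _)
  have hGi : Integrable G := (mp.integrable_comp_emb me).2 hi
  have h1 : ∀ ξ : EuclideanSpace ℝ (Fin n), FourierTransform.fourier G ξ =
      Φ ((-(2 * Real.pi)) • (MeasurableEquiv.toLp 2 (Fin n → ℝ)).symm ξ) := by
    intro ξ
    rw [Real.fourier_eq', hΦ]
    simp only
    rw [← mp.integral_comp me]
    congr 1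
    ext v
    rw [smul_eq_mul, mul_comm]
    congr 2
    have : (MeasurableEquiv.toLp 2 (Fin n → ℝ)).symm ξ ⬝ᵥ
        (MeasurableEquiv.toLp 2 (Fin n → ℝ)).symm v = inner ℝ v ξ := by
      simp only [dotProduct, PiLp.inner_apply, RCLike.inner_apply, conj_trivial]
      rfl
    rw [smul_dotProduct, this, smul_eq_mul]
    push_cast
    ring
  have h2pi : -(2 * Real.pi) ≠ 0 := by simp [Real.pi_ne_zero]
  have h2 : Integrable (FourierTransform.fourier G) := by
    have : FourierTransform.fourier G = (fun u => Φ ((-(2 * Real.pi)) • u)) ∘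
        (MeasurableEquiv.toLp 2 (Fin n → ℝ)).symm := funext h1
    rw [this]
    exact (mp.integrable_comp_emb me).2 (hF.comp_smul h2pi)
  have h3 := hGi.fourierInv_fourier_eq h2 (v := 0) hGc.continuousAt
  rw [Real.fourierInv_eq] at h3
  simp only [inner_zero_right, AddChar.map_zero_eq_one, one_smul] at h3
  simp_rw [h1] at h3
  rw [mp.integral_comp me (fun u => Φ ((-(2 * Real.pi)) • u)), Measure.integral_comp_smul] at h3
  have h4 : |((-(2 * Real.pi)) ^ Module.finrank ℝ (Fin n → ℝ))⁻¹| = ((2 * Real.pi) ^ n)⁻¹ := by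
    rw [abs_inv, abs_pow, abs_neg, abs_of_pos (by positivity)]
    simp
  rw [h4] at h3
  have h5 : G 0 = g 0 := rfl
  rw [← h5, ← h3, Complex.real_smul, Complex.ofReal_inv]
  push_cast
  rw [mul_inv_cancel_left₀]
  exact pow_ne_zero _ (by simp [Real.pi_ne_zero])

/-- Smooth compactly supported real functions. -/
def IsTest {E : Type*} [NormedAddCommGroup E] [NormedSpace ℝ E] (ψ : E → ℝ) : Prop :=
  ContDiff ℝ ∞ ψ ∧ HasCompactSupport ψ

/-- The derivative of `ψ` along the vector `w`. -/
noncomputable def dirD {E : Type*} [NormedAddCommGroup E] [NormedSpace ℝ E] (w : E) (ψ : E → ℝ) :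
    E → ℝ :=
  fun z => fderiv ℝ ψ z w

section
variable {E : Type*} [NormedAddCommGroup E] [NormedSpace ℝ E] {ψ : E → ℝ}

theorem IsTest.dirD (h : IsTest ψ) (w : E) : IsTest (dirD w ψ) :=
  ⟨(h.1.fderiv_right (m := ∞) (by simp)).clm_apply contDiff_const, h.2.fderiv_apply ℝ w⟩

theorem IsTest.sub {φ : E → ℝ} (h : IsTest ψ) (h' : IsTest φ) : IsTest (ψ - φ) :=
  ⟨h.1.sub h'.1, h.2.sub h'.2⟩

theorem IsTest.hasLineDerivAt (h : IsTest ψ) (z w : E) :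
    HasLineDerivAt ℝ ψ (_root_.dirD w ψ z) z w :=
  ((h.1.differentiable (by simp)) z).hasFDerivAt.hasLineDerivAt w

end

variable {n : ℕ}

theorem continuous_cexp_dotProduct :
    Continuous fun q : (Fin n → ℝ) × (Fin n → ℝ) => Complex.exp (Complex.I * (q.1 ⬝ᵥ q.2 : ℝ)) := by
  unfold dotProduct
  fun_prop

theorem norm_cexp_I_mul (r : ℝ) : ‖Complex.exp (Complex.I * (r : ℝ))‖ = 1 := by
  rw [mul_comm, Complex.norm_exp_ofReal_mul_I]

/-- Fourier transform in the second variable. -/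
noncomputable def partFourier (ψ : (Fin n → ℝ) × (Fin n → ℝ) → ℝ) (u v : Fin n → ℝ) : ℂ :=
  ∫ y, (ψ (v, y) : ℂ) * Complex.exp (Complex.I * (u ⬝ᵥ y : ℝ))

theorem hasCompactSupport_slice {ψ : (Fin n → ℝ) × (Fin n → ℝ) → ℝ} (hψ : HasCompactSupport ψ)
    (v : Fin n → ℝ) : HasCompactSupport fun y => ψ (v, y) := by
  refine HasCompactSupport.intro (hψ.isCompact.image continuous_snd) fun y hy => ?_
  by_contra h
  exact hy ⟨(v, y), subset_tsupport _ h, rfl⟩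

theorem integrable_slice_mul {ψ : (Fin n → ℝ) × (Fin n → ℝ) → ℝ} (hψ : IsTest ψ)
    (u v : Fin n → ℝ) :
    Integrable fun y => (ψ (v, y) : ℂ) * Complex.exp (Complex.I * (u ⬝ᵥ y : ℝ)) := by
  refine Continuous.integrable_of_hasCompactSupport ?_ ?_
  · have := continuous_cexp_dotProduct.comp (Continuous.prodMk_right (X := Fin n → ℝ) u)
    have h2 := hψ.1.continuous
    exact (by fun_prop : Continuous fun y => (ψ (v, y) : ℂ)).mul this
  · exact ((hasCompactSupport_slice hψ.2 v).comp_left (g := fun r : ℝ => (r : ℂ)) (by simp)).mul_right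

theorem continuous_partFourier {ψ : (Fin n → ℝ) × (Fin n → ℝ) → ℝ} (hψ : IsTest ψ) :
    Continuous fun q : (Fin n → ℝ) × (Fin n → ℝ) => partFourier ψ q.1 q.2 := by
  have hK := hψ.2.isCompact.image continuous_snd
  have key : (fun q : (Fin n → ℝ) × (Fin n → ℝ) => partFourier ψ q.1 q.2) = fun q =>
      ∫ y in Prod.snd '' tsupport ψ,
        (ψ (q.2, y) : ℂ) * Complex.exp (Complex.I * (q.1 ⬝ᵥ y : ℝ)) := by
    ext q
    refine (setIntegral_eq_integral_of_forall_compl_eq_zero fun y hy => ?_).symm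
    have : ψ (q.2, y) = 0 := by
      by_contra h
      exact hy ⟨_, subset_tsupport _ h, rfl⟩
    simp [this]
  rw [key]
  refine continuous_parametric_integral_of_continuous ?_ hK
  have h1 : Continuous fun a : ((Fin n → ℝ) × (Fin n → ℝ)) × (Fin n → ℝ) =>
      Complex.exp (Complex.I * (a.1.1 ⬝ᵥ a.2 : ℝ)) :=
    continuous_cexp_dotProduct.comp (f := fun a : ((Fin n → ℝ) × (Fin n → ℝ)) × (Fin n → ℝ) =>
      (a.1.1, a.2)) (by fun_prop)
  have h2 := hψ.1.continuous
  exact (by fun_prop : Continuous fun a : ((Fin n → ℝ) × (Fin n → ℝ)) × (Fin n → ℝ) =>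
    (ψ (a.1.2, a.2) : ℂ)).mul h1

theorem norm_partFourier_le {ψ : (Fin n → ℝ) × (Fin n → ℝ) → ℝ} (hψ : IsTest ψ) :
    ∃ C, ∀ u v, ‖partFourier ψ u v‖ ≤ C := by
  obtain ⟨c, hc⟩ := hψ.1.continuous.bounded_above_of_compact_support hψ.2
  have hK := hψ.2.isCompact.image continuous_snd
  refine ⟨c * volume.real (Prod.snd '' tsupport ψ), fun u v => ?_⟩
  have : partFourier ψ u v = ∫ y in Prod.snd '' tsupport ψ,
        (ψ (v, y) : ℂ) * Complex.exp (Complex.I * (u ⬝ᵥ y : ℝ)) := by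
    refine (setIntegral_eq_integral_of_forall_compl_eq_zero fun y hy => ?_).symm
    have : ψ (v, y) = 0 := by
      by_contra h
      exact hy ⟨_, subset_tsupport _ h, rfl⟩
    simp [this]
  rw [this]
  refine norm_setIntegral_le_of_norm_le_const hK.measure_lt_top fun y _ => ?_
  rw [norm_mul, norm_cexp_I_mul, mul_one, Complex.norm_real]
  exact hc _

theorem mul_partFourier {ψ : (Fin n → ℝ) × (Fin n → ℝ) → ℝ} (hψ : IsTest ψ) (u v : Fin n → ℝ)
    (j : Fin n) :
    (1 + Complex.I * (u j : ℝ)) * partFourier ψ u v =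
      partFourier (ψ - dirD (0, Pi.single j 1) ψ) u v := by
  have hD := hψ.dirD (0, Pi.single j (1 : ℝ))
  have hline : ∀ y : Fin n → ℝ, HasLineDerivAt ℝ (fun y => (ψ (v, y) : ℂ))
      (dirD (0, Pi.single j 1) ψ (v, y) : ℂ) y (Pi.single j 1) := by
    intro y
    have := hψ.hasLineDerivAt (v, y) (0, Pi.single j 1)
    unfold HasLineDerivAt at this ⊢
    simpa using this.ofReal_comp
  have hexp : ∀ y : Fin n → ℝ, HasLineDerivAt ℝ
      (fun y => Complex.exp (Complex.I * (u ⬝ᵥ y : ℝ)))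
      (Complex.I * (u j : ℝ) * Complex.exp (Complex.I * (u ⬝ᵥ y : ℝ))) y (Pi.single j 1) := by
    intro y
    unfold HasLineDerivAt
    have h1 : HasDerivAt (fun t : ℝ => u ⬝ᵥ (y + t • Pi.single j (1 : ℝ))) (u j) 0 := by
      simp only [dotProduct_add, dotProduct_smul, dotProduct_single, mul_one, smul_eq_mul]
      simpa using ((hasDerivAt_id (0 : ℝ)).mul_const (u j)).const_add (u ⬝ᵥ y)
    have h2 := (h1.ofReal_comp.const_mul Complex.I).cexp
    simp only [zero_smul, add_zero] at h2
    rw [mul_comm]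
    exact h2
  have hsl := integrable_slice_mul hψ u v
  have hslD := integrable_slice_mul hD u v
  have hparts := integral_bilinear_hasLineDerivAt_right_eq_neg_left_of_integrable
    (μ := (volume : Measure (Fin n → ℝ))) (B := ContinuousLinearMap.mul ℝ ℂ)
    (f := fun y => (ψ (v, y) : ℂ)) (f' := fun y => (dirD (0, Pi.single j 1) ψ (v, y) : ℂ))
    (g := fun y => Complex.exp (Complex.I * (u ⬝ᵥ y : ℝ)))
    (g' := fun y => Complex.I * (u j : ℝ) * Complex.exp (Complex.I * (u ⬝ᵥ y : ℝ)))
    (v := Pi.single j 1) hslD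
    (by
      refine (hsl.const_mul (Complex.I * (u j : ℝ))).congr (Eventually.of_forall fun y => ?_)
      simp only [ContinuousLinearMap.mul_apply']
      ring) hsl (fun y _ => hline y) (fun y _ => hexp y)
  simp only [ContinuousLinearMap.mul_apply'] at hparts
  unfold partFourier
  have hsub : ∀ y, (((ψ - dirD (0, Pi.single j 1) ψ) (v, y) : ℝ) : ℂ) *
      Complex.exp (Complex.I * (u ⬝ᵥ y : ℝ)) =
      (ψ (v, y) : ℂ) * Complex.exp (Complex.I * (u ⬝ᵥ y : ℝ)) -
      (dirD (0, Pi.single j 1) ψ (v, y) : ℂ) * Complex.exp (Complex.I * (u ⬝ᵥ y : ℝ)) := by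
    intro y
    simp only [Pi.sub_apply]
    push_cast
    ring
  simp_rw [hsub]
  rw [integral_sub hsl hslD, sub_eq_add_neg, ← hparts, add_mul, one_mul, ← integral_const_mul]
  congr 2
  ext y
  ring

theorem prod_mul_norm_partFourier_le (L : List (Fin n)) :
    ∀ {ψ : (Fin n → ℝ) × (Fin n → ℝ) → ℝ}, IsTest ψ →
    ∃ C, ∀ u v, (L.map fun j => ‖1 + Complex.I * (u j : ℝ)‖).prod * ‖partFourier ψ u v‖ ≤ C := by
  induction L with
  | nil => intro ψ hψ; simpa using norm_partFourier_le hψ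
  | cons j L ih =>
    intro ψ hψ
    obtain ⟨C, hC⟩ := ih (hψ.sub (hψ.dirD (0, Pi.single j (1 : ℝ))))
    refine ⟨C, fun u v => ?_⟩
    have := hC u v
    rw [← mul_partFourier hψ, norm_mul] at this
    rw [List.map_cons, List.prod_cons]
    calc _ = _ := by ring
      _ ≤ C := this

theorem norm_partFourier_le_prod {ψ : (Fin n → ℝ) × (Fin n → ℝ) → ℝ} (hψ : IsTest ψ) :
    ∃ C, ∀ u v, ‖partFourier ψ u v‖ ≤ C * ∏ j, (1 + u j ^ 2)⁻¹ := by
  obtain ⟨C, hC⟩ := prod_mul_norm_partFourier_le (List.finRange n ++ List.finRange n) hψ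
  refine ⟨C, fun u v => ?_⟩
  have h := hC u v
  have h1 : ((List.finRange n ++ List.finRange n).map fun j => ‖1 + Complex.I * (u j : ℝ)‖).prod =
      ∏ j, (1 + u j ^ 2) := by
    rw [List.map_append, List.prod_append, ← List.ofFn_eq_map, List.prod_ofFn,
      ← Finset.prod_mul_distrib]
    refine Finset.prod_congr rfl fun j _ => ?_
    rw [← sq, ← Complex.normSq_eq_norm_sq, Complex.normSq_apply]
    simp
    ring
  rw [h1] at h
  rw [Finset.prod_inv_distrib, ← div_eq_mul_inv, le_div_iff₀, mul_comm]
  · exact h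
  · exact Finset.prod_pos fun j _ => by positivity

theorem integrable_prod_inv : Integrable fun u : Fin n → ℝ => ∏ j, (1 + u j ^ 2)⁻¹ :=
  Integrable.fintype_prod (fun _ => integrable_inv_one_add_sq)

/-- The scalar oscillatory integral of a rescaled test function, after rescaling. -/
theorem integral_cutoff_eq {ψ : (Fin n → ℝ) × (Fin n → ℝ) → ℝ} (hψ : IsTest ψ)
    (y₀ : (Fin n → ℝ) × (Fin n → ℝ)) {ε : ℝ} (hε : 0 < ε) :
    ∫ y : (Fin n → ℝ) × (Fin n → ℝ),
      (ψ (ε • (y - y₀)) : ℂ) * Complex.exp (Complex.I * (y.1 ⬝ᵥ y.2 : ℝ)) =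
    ∫ u : Fin n → ℝ, Complex.exp (Complex.I * (ε * (u ⬝ᵥ y₀.2) : ℝ)) *
      partFourier ψ u (ε • (ε • u - y₀.1)) := by
  have hψc := hψ.1.continuous
  have hInt : Integrable fun y : (Fin n → ℝ) × (Fin n → ℝ) =>
      (ψ (ε • (y - y₀)) : ℂ) * Complex.exp (Complex.I * (y.1 ⬝ᵥ y.2 : ℝ)) := by
    refine Continuous.integrable_of_hasCompactSupport ?_ ?_
    · exact (by fun_prop : Continuous fun y : (Fin n → ℝ) × (Fin n → ℝ) =>
        (ψ (ε • (y - y₀)) : ℂ)).mul continuous_cexp_dotProduct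
    · have h1 : HasCompactSupport fun y => ψ (ε • (y - y₀)) :=
        hψ.2.comp_homeomorph ((Homeomorph.subRight y₀).trans (Homeomorph.smulOfNeZero ε hε.ne'))
      exact (h1.comp_left (g := fun r : ℝ => (r : ℂ)) (by simp)).mul_right
  rw [Measure.volume_eq_prod] at hInt ⊢
  rw [integral_prod _ hInt]
  have inner : ∀ p : Fin n → ℝ, ∫ x : Fin n → ℝ, (ψ (ε • ((p, x) - y₀)) : ℂ) *
      Complex.exp (Complex.I * (p ⬝ᵥ x : ℝ)) =
      (|(ε ^ n)⁻¹| : ℝ) • (Complex.exp (Complex.I * (p ⬝ᵥ y₀.2 : ℝ)) *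
        partFourier ψ (ε⁻¹ • p) (ε • (p - y₀.1))) := by
    intro p
    rw [← integral_add_right_eq_self _ y₀.2]
    unfold partFourier
    rw [← integral_const_mul]
    have := Measure.integral_comp_smul (volume : Measure (Fin n → ℝ)) (fun y =>
      Complex.exp (Complex.I * (p ⬝ᵥ y₀.2 : ℝ)) * ((ψ (ε • (p - y₀.1), y) : ℂ) *
        Complex.exp (Complex.I * ((ε⁻¹ • p) ⬝ᵥ y : ℝ)))) ε
    rw [Module.finrank_fin_fun] at this
    rw [← this]
    congr 1
    ext x
    have e1 : ε • ((p, x + y₀.2) - y₀) = (ε • (p - y₀.1), ε • x) := by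
      ext <;> simp
    rw [e1, dotProduct_add, smul_dotProduct, dotProduct_smul, smul_smul, inv_mul_cancel₀ hε.ne',
      one_smul, Complex.ofReal_add, mul_add, Complex.exp_add]
    ring
  simp_rw [inner]
  rw [integral_smul]
  have := Measure.integral_comp_smul (volume : Measure (Fin n → ℝ)) (fun p =>
      Complex.exp (Complex.I * (p ⬝ᵥ y₀.2 : ℝ)) *
        partFourier ψ (ε⁻¹ • p) (ε • (p - y₀.1))) ε
  rw [Module.finrank_fin_fun] at this
  rw [← this]
  congr 1
  ext u
  rw [smul_smul, inv_mul_cancel₀ hε.ne', one_smul, smul_dotProduct, smul_eq_mul]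

theorem norm_integral_cutoff_le {ψ : (Fin n → ℝ) × (Fin n → ℝ) → ℝ} (hψ : IsTest ψ)
    (y₀ : (Fin n → ℝ) × (Fin n → ℝ)) :
    ∃ C, ∀ ε : ℝ, 0 < ε → ‖∫ y : (Fin n → ℝ) × (Fin n → ℝ),
      (ψ (ε • (y - y₀)) : ℂ) * Complex.exp (Complex.I * (y.1 ⬝ᵥ y.2 : ℝ))‖ ≤ C := by
  obtain ⟨C, hC⟩ := norm_partFourier_le_prod hψ
  refine ⟨∫ u : Fin n → ℝ, C * ∏ j, (1 + u j ^ 2)⁻¹, fun ε hε => ?_⟩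
  rw [integral_cutoff_eq hψ y₀ hε]
  refine norm_integral_le_of_norm_le (integrable_prod_inv.const_mul C)
    (Eventually.of_forall fun u => ?_)
  rw [norm_mul, norm_cexp_I_mul, one_mul]
  exact hC _ _

theorem tendsto_integral_cutoff {ψ : (Fin n → ℝ) × (Fin n → ℝ) → ℝ} (hψ : IsTest ψ)
    (y₀ : (Fin n → ℝ) × (Fin n → ℝ)) :
    Tendsto (fun ε : ℝ => ∫ y : (Fin n → ℝ) × (Fin n → ℝ),
      (ψ (ε • (y - y₀)) : ℂ) * Complex.exp (Complex.I * (y.1 ⬝ᵥ y.2 : ℝ)))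
      (nhdsWithin 0 (Set.Ioi 0)) (nhds ((2 * Real.pi) ^ n * ψ 0)) := by
  obtain ⟨C, hC⟩ := norm_partFourier_le_prod hψ
  have hcont := continuous_partFourier hψ
  have hψc := hψ.1.continuous
  have hlim : ∫ u : Fin n → ℝ, partFourier ψ u 0 = (2 * Real.pi) ^ n * ψ 0 := by
    refine integral_integral_cexp_dotProduct (fun y => (ψ (0, y) : ℂ)) (by fun_prop) ?_ ?_
    · simpa using integrable_slice_mul hψ 0 0
    · refine (integrable_prod_inv.const_mul C).mono' ?_ (Eventually.of_forall fun u => hC u 0)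
      exact (hcont.comp (by fun_prop : Continuous fun u : Fin n → ℝ =>
        (u, (0 : Fin n → ℝ)))).aestronglyMeasurable
  rw [← hlim]
  have hI : ∀ ε : ℝ, Continuous fun u : Fin n → ℝ =>
      Complex.exp (Complex.I * (ε * (u ⬝ᵥ y₀.2) : ℝ)) * partFourier ψ u (ε • (ε • u - y₀.1)) := by
    intro ε
    refine Continuous.mul ?_ (hcont.comp (by fun_prop : Continuous fun u : Fin n → ℝ =>
      (u, ε • (ε • u - y₀.1))))
    unfold dotProduct
    fun_prop
  have hI' : ∀ u : Fin n → ℝ, Continuous fun ε : ℝ =>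
      Complex.exp (Complex.I * (ε * (u ⬝ᵥ y₀.2) : ℝ)) * partFourier ψ u (ε • (ε • u - y₀.1)) := by
    intro u
    refine Continuous.mul (by fun_prop) (hcont.comp (by fun_prop : Continuous fun ε : ℝ =>
      (u, ε • (ε • u - y₀.1))))
  have := tendsto_integral_filter_of_dominated_convergence
    (μ := (volume : Measure (Fin n → ℝ))) (l := nhdsWithin (0 : ℝ) (Set.Ioi 0))
    (F := fun ε u => Complex.exp (Complex.I * (ε * (u ⬝ᵥ y₀.2) : ℝ)) *
      partFourier ψ u (ε • (ε • u - y₀.1)))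
    (f := fun u => partFourier ψ u 0)
    (fun u => C * ∏ j, (1 + u j ^ 2)⁻¹)
    (Eventually.of_forall fun ε => (hI ε).aestronglyMeasurable)
    (Eventually.of_forall fun ε => Eventually.of_forall fun u => by
      rw [norm_mul, norm_cexp_I_mul, one_mul]
      exact hC _ _)
    (integrable_prod_inv.const_mul C)
    (Eventually.of_forall fun u => by
      have := ((hI' u).tendsto 0).mono_left (nhdsWithin_le_nhds (s := Set.Ioi (0 : ℝ)))
      simpa using this)
  refine this.congr' ?_
  filter_upwards [self_mem_nhdsWithin] with ε hε
  exact (integral_cutoff_eq hψ y₀ hε).symm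

end Scalar

section Core

open NormedSpace (exp)

variable {B : Type*} [NormedRing B] [NormedAlgebra ℂ B] [CompleteSpace B]

theorem exp_add_of_commute_complex {x y : B} (h : Commute x y) : exp (x + y) = exp x * exp y :=
  letI : NormedAlgebra ℚ B := NormedAlgebra.restrictScalars ℚ ℂ B
  NormedSpace.exp_add_of_commute h

theorem continuous_exp_complex : Continuous (exp : B → B) :=
  letI : NormedAlgebra ℚ B := NormedAlgebra.restrictScalars ℚ ℂ B
  NormedSpace.exp_continuous

theorem hasDerivAt_exp_add_smul {c a : B} (h : Commute c a) :
    HasDerivAt (fun s : ℝ => exp (c + s • a)) (exp c * a) 0 := by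
  have h1 := (hasDerivAt_exp_smul_const a (0 : ℝ)).const_mul (exp c)
  simp only [zero_smul, NormedSpace.exp_zero, one_mul] at h1
  refine h1.congr_of_eventuallyEq (Eventually.of_forall fun s => ?_)
  exact exp_add_of_commute_complex (h.smul_right s)

theorem hasDerivAt_exp_smul_add_sq {a b : B} (h : Commute a b) (t : ℝ) :
    HasDerivAt (fun s : ℝ => exp (s • a + s ^ 2 • b))
      (exp (t • a + t ^ 2 • b) * (a + (2 * t) • b)) t := by
  have hab : ∀ s : ℝ, Commute (s • a) (s ^ 2 • b) := fun s => (h.smul_left _).smul_right _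
  have h1 := hasDerivAt_exp_smul_const a t
  have h2 := (hasDerivAt_exp_smul_const b (t ^ 2)).scomp t ((hasDerivAt_id t).pow 2)
  have h3 := h1.mul h2
  refine (h3.congr_of_eventuallyEq (Eventually.of_forall fun s =>
    exp_add_of_commute_complex (hab s))).congr_deriv ?_
  have hc : Commute a (exp (t ^ 2 • b)) := (h.smul_right _).exp_right
  rw [exp_add_of_commute_complex (hab t)]
  simp only [mul_add, mul_assoc, ← hc.eq]
  simp [hc.eq]

/-- Differentiation under the integral sign for integrands supported in a fixed compact set. -/
theorem hasDerivAt_integral_of_compact {Y : Type*} [TopologicalSpace Y] [MeasurableSpace Y]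
    [OpensMeasurableSpace Y] [T2Space Y] [SecondCountableTopology Y] {μ : Measure Y}
    [IsFiniteMeasureOnCompacts μ] {V : Type*} [NormedAddCommGroup V] [NormedSpace ℝ V]
    {F F' : ℝ → Y → V} (hF : Continuous (Function.uncurry F))
    (hF' : Continuous (Function.uncurry F')) {K : Set Y} (hK : IsCompact K)
    (h0 : ∀ t, ∀ y ∉ K, F t y = 0) (h0' : ∀ t, ∀ y ∉ K, F' t y = 0)
    (hd : ∀ t y, HasDerivAt (fun s => F s y) (F' t y) t) (t : ℝ) :
    HasDerivAt (fun s => ∫ y, F s y ∂μ) (∫ y, F' t y ∂μ) t := by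
  obtain ⟨c, hc⟩ := ((isCompact_Icc (a := t - 1) (b := t + 1)).prod hK).exists_bound_of_continuousOn
    hF'.continuousOn
  have hFt : ∀ s, Continuous (F s) := fun s => hF.comp (Continuous.prodMk_right s)
  have hInt : Integrable (F t) μ :=
    ((hFt t).continuousOn.integrableOn_compact hK).integrable_of_forall_notMem_eq_zero
      fun y hy => h0 t y hy
  refine (hasDerivAt_integral_of_dominated_loc_of_deriv_le
    (bound := K.indicator fun _ => c) (s := Set.Icc (t - 1) (t + 1))
    (Icc_mem_nhds (by linarith) (by linarith))
    (Eventually.of_forall fun s => (hFt s).aestronglyMeasurable) hInt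
    (hF'.comp (Continuous.prodMk_right t)).aestronglyMeasurable
    (Eventually.of_forall fun y s hs => ?_) ?_ (Eventually.of_forall fun y s _ => hd s y)).2
  · by_cases hy : y ∈ K
    · rw [Set.indicator_of_mem hy]
      exact hc (s, y) ⟨hs, hy⟩
    · rw [Set.indicator_of_notMem hy, h0' s y hy, norm_zero]
  · rw [integrable_indicator_iff hK.measurableSet]
    exact integrableOn_const hK.measure_lt_top.ne

variable {n : ℕ}

/-- The exponent `-i ∑ⱼ Pⱼ Qⱼ` obtained by completing the square. -/
noncomputable def squareTerm (E : (Fin n → ℝ) × (Fin n → ℝ) →ₗ[ℝ] B) : B :=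
  -(Complex.I • ∑ j, E (Pi.single j 1, 0) * E (0, Pi.single j 1))

/-- The phase `e^{ip·x}` translated by `t` times the imaginary vector that completes the square. -/
noncomputable def shiftedPhase (E : (Fin n → ℝ) × (Fin n → ℝ) →ₗ[ℝ] B) (t : ℝ)
    (y : (Fin n → ℝ) × (Fin n → ℝ)) : B :=
  Complex.exp (Complex.I * (y.1 ⬝ᵥ y.2 : ℝ)) • exp (t • E y + t ^ 2 • squareTerm E)

omit [CompleteSpace B] in
theorem linear_eq_sum (E : (Fin n → ℝ) × (Fin n → ℝ) →ₗ[ℝ] B) (y : (Fin n → ℝ) × (Fin n → ℝ)) :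
    E y = ∑ j, (y.1 j • E (Pi.single j 1, 0) + y.2 j • E (0, Pi.single j 1)) := by
  have h : y = ∑ j, (y.1 j • ((Pi.single j 1, 0) : (Fin n → ℝ) × (Fin n → ℝ)) +
      y.2 j • ((0, Pi.single j 1) : (Fin n → ℝ) × (Fin n → ℝ))) := by
    ext i <;> simp [Prod.fst_sum, Prod.snd_sum, Finset.sum_apply, Pi.single_apply]
  conv_lhs => rw [h]
  simp only [map_sum, map_add, map_smul]

variable {E : (Fin n → ℝ) × (Fin n → ℝ) →ₗ[ℝ] B}

omit [CompleteSpace B] in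
theorem commute_squareTerm (hE : ∀ u v, Commute (E u) (E v)) (u : (Fin n → ℝ) × (Fin n → ℝ)) :
    Commute (E u) (squareTerm E) :=
  ((Commute.sum_right _ _ _ fun _ _ => (hE _ _).mul_right (hE _ _)).smul_right _).neg_right

theorem continuous_shiftedPhase : Continuous (Function.uncurry (shiftedPhase E)) := by
  have hc : Continuous E := E.continuous_of_finiteDimensional
  have h1 : Continuous fun a : ℝ × ((Fin n → ℝ) × (Fin n → ℝ)) =>
      Complex.exp (Complex.I * (a.2.1 ⬝ᵥ a.2.2 : ℝ)) := continuous_cexp_dotProduct.comp continuous_snd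
  refine h1.smul (continuous_exp_complex.comp ?_)
  fun_prop

theorem hasLineDerivAt_shiftedPhase (hE : ∀ u v, Commute (E u) (E v)) (t : ℝ)
    (y v : (Fin n → ℝ) × (Fin n → ℝ)) :
    HasLineDerivAt ℝ (shiftedPhase E t)
      ((Complex.I * (y.1 ⬝ᵥ v.2 + v.1 ⬝ᵥ y.2 : ℝ)) • shiftedPhase E t y +
        shiftedPhase E t y * (t • E v)) y v := by
  unfold HasLineDerivAt
  have h1 : HasDerivAt (fun s : ℝ => (y.1 + s • v.1) ⬝ᵥ (y.2 + s • v.2))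
      (y.1 ⬝ᵥ v.2 + v.1 ⬝ᵥ y.2) 0 := by
    have : ∀ s : ℝ, (y.1 + s • v.1) ⬝ᵥ (y.2 + s • v.2) =
        y.1 ⬝ᵥ y.2 + s * (y.1 ⬝ᵥ v.2 + v.1 ⬝ᵥ y.2) + s ^ 2 * (v.1 ⬝ᵥ v.2) := by
      intro s
      simp only [dotProduct_add, add_dotProduct, smul_dotProduct, dotProduct_smul, smul_eq_mul]
      ring
    simp_rw [this]
    have := (((hasDerivAt_id (0 : ℝ)).mul_const (y.1 ⬝ᵥ v.2 + v.1 ⬝ᵥ y.2)).const_add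
      (y.1 ⬝ᵥ y.2)).add (((hasDerivAt_id (0 : ℝ)).pow 2).mul_const (v.1 ⬝ᵥ v.2))
    refine (this.congr_of_eventuallyEq (Eventually.of_forall fun s => rfl)).congr_deriv ?_
    simp
  have h2 := (h1.ofReal_comp.const_mul Complex.I).cexp
  have hcom : Commute (t • E y + t ^ 2 • squareTerm E) (t • E v) :=
    (((hE y v).smul_left _).add_left ((commute_squareTerm hE v).symm.smul_left _)).smul_right _
  have h3 := h2.smul (hasDerivAt_exp_add_smul hcom)
  simp only [zero_smul, add_zero] at h3
  refine (h3.congr_of_eventuallyEq (Eventually.of_forall fun s => ?_)).congr_deriv ?_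
  · unfold shiftedPhase
    simp only [Prod.fst_add, Prod.snd_add, Prod.smul_fst, Prod.smul_snd, map_add, map_smul,
      Pi.smul_apply']
    congr 2
    module
  · unfold shiftedPhase
    rw [smul_mul_assoc, add_comm, smul_smul]
    congr 2
    ring

theorem hasDerivAt_shiftedPhase (hE : ∀ u v, Commute (E u) (E v)) (t : ℝ)
    (y : (Fin n → ℝ) × (Fin n → ℝ)) :
    HasDerivAt (fun s => shiftedPhase E s y)
      (shiftedPhase E t y * (E y + (2 * t) • squareTerm E)) t := by
  have := (hasDerivAt_exp_smul_add_sq (commute_squareTerm hE y) t).const_smul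
    (Complex.exp (Complex.I * (y.1 ⬝ᵥ y.2 : ℝ)))
  unfold shiftedPhase
  rw [smul_mul_assoc]
  exact this

/-- The derivative of the translated phase along `v`, multiplied by `i E w`. -/
noncomputable def lineTerm (E : (Fin n → ℝ) × (Fin n → ℝ) →ₗ[ℝ] B) (t : ℝ)
    (v w y : (Fin n → ℝ) × (Fin n → ℝ)) : B :=
  ((Complex.I * (y.1 ⬝ᵥ v.2 + v.1 ⬝ᵥ y.2 : ℝ)) • shiftedPhase E t y +
    shiftedPhase E t y * (t • E v)) * (Complex.I • E w)

omit [CompleteSpace B] in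
/-- Translating the phase amounts to differentiating it. -/
theorem shiftedPhase_mul_eq (hE : ∀ u v, Commute (E u) (E v)) (t : ℝ)
    (y : (Fin n → ℝ) × (Fin n → ℝ)) :
    shiftedPhase E t y * (E y + (2 * t) • squareTerm E) =
      -∑ j, (lineTerm E t (Pi.single j 1, 0) (0, Pi.single j 1) y +
        lineTerm E t (0, Pi.single j 1) (Pi.single j 1, 0) y) := by
  unfold lineTerm
  rw [linear_eq_sum E y, squareTerm, mul_add]
  simp only [Finset.mul_sum, Finset.smul_sum, ← Finset.sum_neg_distrib]
  rw [← Finset.sum_add_distrib]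
  refine Finset.sum_congr rfl fun j _ => ?_
  have hc := (hE (Pi.single j 1, 0) (0, Pi.single j 1)).eq
  set P := E (Pi.single j 1, 0)
  set Q := E (0, Pi.single j 1)
  set h := shiftedPhase E t y
  simp only [dotProduct_zero, zero_dotProduct, single_dotProduct, dotProduct_single, zero_add,
    add_zero, one_mul, mul_one, add_mul, mul_add, smul_mul_assoc, mul_smul_comm, mul_assoc, ← hc,
    mul_neg, smul_neg, mul_smul, Complex.coe_smul]
  match_scalars <;> ring_nf <;> simp

theorem IsTest.comp_affine {F : Type*} [NormedAddCommGroup F] [NormedSpace ℝ F] {ψ : F → ℝ}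
    (hψ : IsTest ψ) (y₀ : F) {ε : ℝ} (hε : 0 < ε) : IsTest fun y => ψ (ε • (y - y₀)) :=
  ⟨hψ.1.comp ((contDiff_id.sub contDiff_const).const_smul ε),
    hψ.2.comp_homeomorph ((Homeomorph.subRight y₀).trans (Homeomorph.smulOfNeZero ε hε.ne'))⟩

theorem IsTest.integrable_smul {F : Type*} [NormedAddCommGroup F] [NormedSpace ℝ F]
    [MeasurableSpace F] [BorelSpace F] {μ : Measure F} [IsFiniteMeasureOnCompacts μ]
    {V : Type*} [NormedAddCommGroup V] [NormedSpace ℝ V] {ψ : F → ℝ} (hψ : IsTest ψ) {f : F → V}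
    (hf : Continuous f) : Integrable (fun y => ψ y • f y) μ :=
  (hψ.1.continuous.smul hf).integrable_of_hasCompactSupport hψ.2.smul_right

/-- The cut-off integral of the translated phase. -/
noncomputable def cutPhase (E : (Fin n → ℝ) × (Fin n → ℝ) →ₗ[ℝ] B)
    (y₀ : (Fin n → ℝ) × (Fin n → ℝ)) (ψ : (Fin n → ℝ) × (Fin n → ℝ) → ℝ) (ε t : ℝ) : B :=
  ∫ y, ψ (ε • (y - y₀)) • shiftedPhase E t y

theorem continuous_shiftedPhase_right (t : ℝ) : Continuous (shiftedPhase E t) :=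
  continuous_shiftedPhase.comp (Continuous.prodMk_right t)

theorem isAddHaarMeasure_volume_prod :
    (volume : Measure ((Fin n → ℝ) × (Fin n → ℝ))).IsAddHaarMeasure := by
  exact Measure.prod.instIsAddHaarMeasure _ _

theorem integral_smul_lineDeriv (hE : ∀ u v, Commute (E u) (E v))
    (y₀ : (Fin n → ℝ) × (Fin n → ℝ)) {ψ : (Fin n → ℝ) × (Fin n → ℝ) → ℝ} (hψ : IsTest ψ)
    {ε : ℝ} (hε : 0 < ε) (t : ℝ) (v : (Fin n → ℝ) × (Fin n → ℝ)) :
    ∫ y : (Fin n → ℝ) × (Fin n → ℝ), ψ (ε • (y - y₀)) •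
      ((Complex.I * (y.1 ⬝ᵥ v.2 + v.1 ⬝ᵥ y.2 : ℝ)) • shiftedPhase E t y +
        shiftedPhase E t y * (t • E v)) = -(ε • cutPhase E y₀ (dirD v ψ) ε t) := by
  have hc := continuous_shiftedPhase_right (E := E) t
  have hψε := hψ.comp_affine y₀ hε
  have hDε := (hψ.dirD v).comp_affine y₀ hε
  have hdot : Continuous fun y : (Fin n → ℝ) × (Fin n → ℝ) => y.1 ⬝ᵥ v.2 + v.1 ⬝ᵥ y.2 := by
    unfold dotProduct
    fun_prop
  have := isAddHaarMeasure_volume_prod (n := n)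
  have hI := integral_bilinear_hasLineDerivAt_right_eq_neg_left_of_integrable
    (μ := (volume : Measure ((Fin n → ℝ) × (Fin n → ℝ))))
    (B := (ContinuousLinearMap.lsmul ℝ ℝ : ℝ →L[ℝ] B →L[ℝ] B))
    (f := fun y => ψ (ε • (y - y₀))) (f' := fun y => ε * dirD v ψ (ε • (y - y₀)))
    (g := shiftedPhase E t)
    (g' := fun y => (Complex.I * (y.1 ⬝ᵥ v.2 + v.1 ⬝ᵥ y.2 : ℝ)) • shiftedPhase E t y +
        shiftedPhase E t y * (t • E v)) (v := v)
    (by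
      refine ((hDε.integrable_smul hc).smul ε).congr (Eventually.of_forall fun y => ?_)
      simp [mul_smul])
    (hψε.integrable_smul (by fun_prop))
    (hψε.integrable_smul hc)
    (fun y _ => by
      have := hψ.hasLineDerivAt (ε • (y - y₀)) (ε • v)
      have e : dirD (ε • v) ψ (ε • (y - y₀)) = ε * dirD v ψ (ε • (y - y₀)) := by
        simp [dirD]
      rw [e] at this
      unfold HasLineDerivAt at this ⊢
      refine this.congr_of_eventuallyEq (Eventually.of_forall fun s => ?_)
      simp only
      congr 1
      module)
    (fun y _ => hasLineDerivAt_shiftedPhase hE t y v)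
  simp only [ContinuousLinearMap.lsmul_apply] at hI
  rw [hI, cutPhase, ← integral_smul]
  simp only [mul_smul]

theorem integrable_smul_lineTerm (y₀ : (Fin n → ℝ) × (Fin n → ℝ))
    {ψ : (Fin n → ℝ) × (Fin n → ℝ) → ℝ} (hψ : IsTest ψ) {ε : ℝ} (hε : 0 < ε) (t : ℝ)
    (v w : (Fin n → ℝ) × (Fin n → ℝ)) :
    Integrable fun y => ψ (ε • (y - y₀)) • lineTerm E t v w y := by
  have hct := continuous_shiftedPhase_right (E := E) t
  have hdot : Continuous fun y : (Fin n → ℝ) × (Fin n → ℝ) => y.1 ⬝ᵥ v.2 + v.1 ⬝ᵥ y.2 := by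
    unfold dotProduct
    fun_prop
  refine (hψ.comp_affine y₀ hε).integrable_smul ?_
  unfold lineTerm
  fun_prop

theorem integral_smul_lineTerm (hE : ∀ u v, Commute (E u) (E v))
    (y₀ : (Fin n → ℝ) × (Fin n → ℝ)) {ψ : (Fin n → ℝ) × (Fin n → ℝ) → ℝ} (hψ : IsTest ψ)
    {ε : ℝ} (hε : 0 < ε) (t : ℝ) (v w : (Fin n → ℝ) × (Fin n → ℝ)) :
    ∫ y, ψ (ε • (y - y₀)) • lineTerm E t v w y =
      -(ε • (cutPhase E y₀ (dirD v ψ) ε t * (Complex.I • E w))) := by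
  have hct := continuous_shiftedPhase_right (E := E) t
  have hdot : Continuous fun y : (Fin n → ℝ) × (Fin n → ℝ) => y.1 ⬝ᵥ v.2 + v.1 ⬝ᵥ y.2 := by
    unfold dotProduct
    fun_prop
  have hInt : Integrable fun y : (Fin n → ℝ) × (Fin n → ℝ) =>
      ψ (ε • (y - y₀)) • (((Complex.I * (y.1 ⬝ᵥ v.2 + v.1 ⬝ᵥ y.2 : ℝ)) • shiftedPhase E t y +
        shiftedPhase E t y * (t • E v))) :=
    (hψ.comp_affine y₀ hε).integrable_smul (by fun_prop)
  simp only [lineTerm, ← smul_mul_assoc (ψ _)]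
  rw [integral_mul_const_of_integrable hInt, integral_smul_lineDeriv hE y₀ hψ hε, neg_mul,
    smul_mul_assoc]

theorem hasDerivAt_cutPhase (hE : ∀ u v, Commute (E u) (E v))
    (y₀ : (Fin n → ℝ) × (Fin n → ℝ)) {ψ : (Fin n → ℝ) × (Fin n → ℝ) → ℝ} (hψ : IsTest ψ)
    {ε : ℝ} (hε : 0 < ε) (t : ℝ) :
    HasDerivAt (cutPhase E y₀ ψ ε)
      (ε • ∑ j, (cutPhase E y₀ (dirD (Pi.single j 1, 0) ψ) ε t * (Complex.I • E (0, Pi.single j 1)) +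
        cutPhase E y₀ (dirD (0, Pi.single j 1) ψ) ε t * (Complex.I • E (Pi.single j 1, 0)))) t := by
  have hψε := hψ.comp_affine y₀ hε
  have hc := continuous_shiftedPhase (E := E)
  have hct := continuous_shiftedPhase_right (E := E) t
  have hEc : Continuous E := E.continuous_of_finiteDimensional
  have hψc := hψ.1.continuous
  have hc' : Continuous fun a : ℝ × ((Fin n → ℝ) × (Fin n → ℝ)) => shiftedPhase E a.1 a.2 := hc
  have hd := hasDerivAt_integral_of_compact (μ := (volume : Measure ((Fin n → ℝ) × (Fin n → ℝ))))
    (F := fun t y => ψ (ε • (y - y₀)) • shiftedPhase E t y)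
    (F' := fun t y => ψ (ε • (y - y₀)) • (shiftedPhase E t y * (E y + (2 * t) • squareTerm E)))
    (by simp only [Function.uncurry_def]; fun_prop)
    (by simp only [Function.uncurry_def]; fun_prop) hψε.2.isCompact
    (fun t y hy => by simp only [image_eq_zero_of_notMem_tsupport hy, zero_smul])
    (fun t y hy => by simp only [image_eq_zero_of_notMem_tsupport hy, zero_smul])
    (fun t y => (hasDerivAt_shiftedPhase hE t y).const_smul _) t
  refine hd.congr_deriv ?_
  have hmul := integral_smul_lineTerm hE y₀ hψ hε t
  have hInt := integrable_smul_lineTerm (E := E) y₀ hψ hε t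
  simp only [shiftedPhase_mul_eq hE, smul_neg, integral_neg, Finset.smul_sum, smul_add]
  rw [integral_finsetSum _ fun j _ => ?_, ← Finset.sum_neg_distrib]
  on_goal 2 => exact (hInt _ _).add (hInt _ _)
  refine Finset.sum_congr rfl fun j _ => ?_
  rw [neg_eq_iff_eq_neg, neg_add, ← hmul, ← hmul]
  exact integral_add (hInt _ _) (hInt _ _)

end Core

section CoreLimit

open NormedSpace (exp)

variable {B : Type*} [NormedRing B] [NormedAlgebra ℂ B] [CompleteSpace B] {n : ℕ}
  {E : (Fin n → ℝ) × (Fin n → ℝ) →ₗ[ℝ] B}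

theorem norm_shiftedPhase_le (hE : ∀ u v, Commute (E u) (E v)) {C : ℝ} {k : ℕ}
    (hC : ∀ y, ‖exp (E y)‖ ≤ C * (1 + ‖y‖) ^ k) :
    ∃ D, 0 ≤ D ∧ ∀ t ∈ Set.Icc (0 : ℝ) 1, ∀ y, ‖shiftedPhase E t y‖ ≤ D * (1 + ‖y‖) ^ k := by
  have hC0 : 0 ≤ C := by
    have := (norm_nonneg _).trans (hC 0)
    simpa using this
  obtain ⟨c, hc⟩ := (isCompact_Icc (a := (0 : ℝ)) (b := 1)).exists_bound_of_continuousOn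
    (f := fun t : ℝ => exp (t ^ 2 • squareTerm E))
    (continuous_exp_complex.comp (by fun_prop)).continuousOn
  have hc0 : 0 ≤ c := (norm_nonneg _).trans (hc 0 ⟨le_rfl, zero_le_one⟩)
  refine ⟨C * c, mul_nonneg hC0 hc0, fun t ht y => ?_⟩
  unfold shiftedPhase
  rw [norm_smul, norm_cexp_I_mul, one_mul, exp_add_of_commute_complex
    (((commute_squareTerm hE y).smul_left _).smul_right _), ← map_smul]
  have h1 : ‖t • y‖ ≤ ‖y‖ := by
    rw [norm_smul, Real.norm_of_nonneg ht.1]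
    exact mul_le_of_le_one_left (norm_nonneg _) ht.2
  calc _ ≤ ‖exp (E (t • y))‖ * ‖exp (t ^ 2 • squareTerm E)‖ := norm_mul_le _ _
    _ ≤ (C * (1 + ‖y‖) ^ k) * c := by
      refine mul_le_mul ((hC _).trans ?_) (hc t ht) (norm_nonneg _) (by positivity)
      gcongr
    _ = _ := by ring

theorem cutPhase_polynomial_bound (hE : ∀ u v, Commute (E u) (E v)) {C : ℝ} {k : ℕ}
    (hC : ∀ y, ‖exp (E y)‖ ≤ C * (1 + ‖y‖) ^ k) (y₀ : (Fin n → ℝ) × (Fin n → ℝ)) :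
    ∃ r : ℕ, ∀ ψ : (Fin n → ℝ) × (Fin n → ℝ) → ℝ, IsTest ψ → ∃ D : ℝ, ∀ ε ∈ Set.Ioc (0 : ℝ) 1,
      ∀ t ∈ Set.Icc (0 : ℝ) 1, ‖cutPhase E y₀ ψ ε t‖ ≤ D * (ε⁻¹) ^ r := by
  have := isAddHaarMeasure_volume_prod (n := n)
  obtain ⟨D, hD0, hD⟩ := norm_shiftedPhase_le hE hC
  refine ⟨k + Module.finrank ℝ ((Fin n → ℝ) × (Fin n → ℝ)), fun ψ hψ => ?_⟩
  set G : (Fin n → ℝ) × (Fin n → ℝ) → ℝ := fun z => ‖ψ z‖ * (D * (1 + ‖z‖ + ‖y₀‖) ^ k) with hG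
  have hGi : Integrable G := by
    have h1 := hψ.1.continuous
    refine Continuous.integrable_of_hasCompactSupport (by fun_prop) ?_
    exact hψ.2.norm.mul_right
  refine ⟨∫ z, G z, fun ε hε t ht => ?_⟩
  have hε0 : 0 < ε := hε.1
  have h1 : cutPhase E y₀ ψ ε t = ∫ y, ψ (ε • y) • shiftedPhase E t (y + y₀) := by
    unfold cutPhase
    rw [← integral_add_right_eq_self _ y₀]
    simp
  have h2 : ‖∫ y, ψ (ε • y) • shiftedPhase E t (y + y₀)‖ ≤ ∫ y, (ε⁻¹) ^ k * G (ε • y) := by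
    refine norm_integral_le_of_norm_le ((hGi.comp_smul hε0.ne').const_mul _)
      (Eventually.of_forall fun y => ?_)
    have h3 : 1 + ‖y + y₀‖ ≤ ε⁻¹ * (1 + ‖ε • y‖ + ‖y₀‖) := by
      rw [norm_smul, Real.norm_of_nonneg hε0.le, mul_add, mul_add, inv_mul_cancel_left₀ hε0.ne']
      have h4 : 1 ≤ ε⁻¹ := (one_le_inv₀ hε0).2 hε.2
      have h5 : ‖y₀‖ ≤ ε⁻¹ * ‖y₀‖ := le_mul_of_one_le_left (norm_nonneg _) h4
      linarith [norm_add_le y y₀]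
    rw [norm_smul]
    calc _ ≤ ‖ψ (ε • y)‖ * (D * (1 + ‖y + y₀‖) ^ k) := by
          gcongr
          exact hD t ht _
      _ ≤ ‖ψ (ε • y)‖ * (D * (ε⁻¹ * (1 + ‖ε • y‖ + ‖y₀‖)) ^ k) := by gcongr
      _ = _ := by
        rw [hG, mul_pow]
        ring
  rw [h1]
  refine h2.trans (le_of_eq ?_)
  rw [integral_const_mul, Measure.integral_comp_smul, abs_of_pos (by positivity), smul_eq_mul,
    pow_add, inv_pow, inv_pow]
  ring

theorem cutPhase_zero (y₀ : (Fin n → ℝ) × (Fin n → ℝ)) (ψ : (Fin n → ℝ) × (Fin n → ℝ) → ℝ)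
    (ε : ℝ) : cutPhase E y₀ ψ ε 0 = (∫ y : (Fin n → ℝ) × (Fin n → ℝ),
      (ψ (ε • (y - y₀)) : ℂ) * Complex.exp (Complex.I * (y.1 ⬝ᵥ y.2 : ℝ))) • (1 : B) := by
  rw [← integral_smul_const]
  unfold cutPhase shiftedPhase
  simp [mul_smul]

theorem norm_deriv_cutPhase_le (hE : ∀ u v, Commute (E u) (E v))
    (y₀ : (Fin n → ℝ) × (Fin n → ℝ)) {r : ℕ}
    (hr : ∀ ψ : (Fin n → ℝ) × (Fin n → ℝ) → ℝ, IsTest ψ → ∃ D : ℝ, ∀ ε ∈ Set.Ioc (0 : ℝ) 1,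
      ∀ t ∈ Set.Icc (0 : ℝ) 1, ‖cutPhase E y₀ ψ ε t‖ ≤ D * (ε⁻¹) ^ r)
    {ψ : (Fin n → ℝ) × (Fin n → ℝ) → ℝ} (hψ : IsTest ψ) :
    ∃ D : ℝ, ∀ ε ∈ Set.Ioc (0 : ℝ) 1, ∀ t ∈ Set.Icc (0 : ℝ) 1,
      ‖cutPhase E y₀ ψ ε t - cutPhase E y₀ ψ ε 0‖ ≤ ε * (D * (ε⁻¹) ^ r) := by
  choose D₁ hD₁ using fun j : Fin n => hr _ (hψ.dirD (Pi.single j (1 : ℝ), (0 : Fin n → ℝ)))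
  choose D₂ hD₂ using fun j : Fin n => hr _ (hψ.dirD ((0 : Fin n → ℝ), Pi.single j (1 : ℝ)))
  set D : ℝ := ∑ j, (D₁ j * ‖Complex.I • E (0, Pi.single j 1)‖ +
    D₂ j * ‖Complex.I • E (Pi.single j 1, 0)‖) with hD
  refine ⟨D, fun ε hε t ht => ?_⟩
  have hb : ∀ s ∈ Set.Icc (0 : ℝ) 1, ‖ε • ∑ j, (cutPhase E y₀ (dirD (Pi.single j 1, 0) ψ) ε s *
      (Complex.I • E (0, Pi.single j 1)) + cutPhase E y₀ (dirD (0, Pi.single j 1) ψ) ε s *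
      (Complex.I • E (Pi.single j 1, 0)))‖ ≤ ε * (D * (ε⁻¹) ^ r) := by
    intro s hs
    rw [norm_smul, Real.norm_of_nonneg hε.1.le, hD, Finset.sum_mul]
    refine mul_le_mul_of_nonneg_left (norm_sum_le_of_le _ fun j _ => ?_) hε.1.le
    calc _ ≤ _ := norm_add_le_of_le (norm_mul_le _ _) (norm_mul_le _ _)
      _ ≤ (D₁ j * (ε⁻¹) ^ r) * ‖Complex.I • E (0, Pi.single j 1)‖ +
          (D₂ j * (ε⁻¹) ^ r) * ‖Complex.I • E (Pi.single j 1, 0)‖ := by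
        gcongr
        · exact hD₁ j ε hε s hs
        · exact hD₂ j ε hε s hs
      _ = _ := by ring
  have h0 : 0 ≤ ε * (D * (ε⁻¹) ^ r) := (norm_nonneg _).trans (hb 0 ⟨le_rfl, zero_le_one⟩)
  have := norm_image_sub_le_of_norm_deriv_le_segment'
    (fun s _ => (hasDerivAt_cutPhase hE y₀ hψ hε.1 s).hasDerivWithinAt)
    (fun s hs => hb s (Set.Ico_subset_Icc_self hs)) t ht
  refine this.trans ?_
  rw [sub_zero]
  exact mul_le_of_le_one_right h0 ht.2

theorem cutPhase_bound (hE : ∀ u v, Commute (E u) (E v)) {C : ℝ} {k : ℕ}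
    (hC : ∀ y, ‖exp (E y)‖ ≤ C * (1 + ‖y‖) ^ k) (y₀ : (Fin n → ℝ) × (Fin n → ℝ)) :
    ∀ ψ : (Fin n → ℝ) × (Fin n → ℝ) → ℝ, IsTest ψ → ∃ D : ℝ, ∀ ε ∈ Set.Ioc (0 : ℝ) 1,
      ∀ t ∈ Set.Icc (0 : ℝ) 1, ‖cutPhase E y₀ ψ ε t‖ ≤ D * (ε⁻¹) ^ 0 := by
  obtain ⟨r, hr⟩ := cutPhase_polynomial_bound hE hC y₀
  induction r with
  | zero => exact hr
  | succ r ih =>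
    refine ih fun ψ hψ => ?_
    obtain ⟨D, hD⟩ := norm_deriv_cutPhase_le hE y₀ hr hψ
    obtain ⟨S, hS⟩ := norm_integral_cutoff_le hψ y₀
    refine ⟨S * ‖(1 : B)‖ + D, fun ε hε t ht => ?_⟩
    have h1 := hD ε hε t ht
    have h2 : ‖cutPhase E y₀ ψ ε 0‖ ≤ S * ‖(1 : B)‖ := by
      rw [cutPhase_zero]
      exact (norm_smul_le _ _).trans (mul_le_mul_of_nonneg_right (hS ε hε.1) (norm_nonneg _))
    have h3 : ε * (D * (ε⁻¹) ^ (r + 1)) = D * (ε⁻¹) ^ r := by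
      rw [pow_succ]
      field_simp [hε.1.ne']
    rw [h3] at h1
    have h4 : (1 : ℝ) ≤ (ε⁻¹) ^ r := one_le_pow₀ ((one_le_inv₀ hε.1).2 hε.2)
    have h5 : S * ‖(1 : B)‖ ≤ S * ‖(1 : B)‖ * (ε⁻¹) ^ r :=
      le_mul_of_one_le_right ((norm_nonneg _).trans h2) h4
    calc _ ≤ ‖cutPhase E y₀ ψ ε 0‖ + ‖cutPhase E y₀ ψ ε t - cutPhase E y₀ ψ ε 0‖ :=
          norm_le_norm_add_norm_sub' _ _
      _ ≤ _ := by rw [add_mul]; linarith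

/-- The oscillatory integral of a polynomially bounded exponential of commuting elements. -/
theorem tendsto_integral_exp (hE : ∀ u v, Commute (E u) (E v)) {C : ℝ} {k : ℕ}
    (hC : ∀ y, ‖exp (E y)‖ ≤ C * (1 + ‖y‖) ^ k) (y₀ : (Fin n → ℝ) × (Fin n → ℝ))
    {ψ : (Fin n → ℝ) × (Fin n → ℝ) → ℝ} (hψ : IsTest ψ) :
    Tendsto (fun ε : ℝ => ∫ y : (Fin n → ℝ) × (Fin n → ℝ), ψ (ε • (y - y₀)) •
        (Complex.exp (Complex.I * (y.1 ⬝ᵥ y.2 : ℝ)) • exp (E y)))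
      (nhdsWithin 0 (Set.Ioi 0))
      (nhds (((2 * Real.pi) ^ n * ψ 0) •
        exp (Complex.I • ∑ j, E (Pi.single j 1, 0) * E (0, Pi.single j 1)))) := by
  obtain ⟨D, hD⟩ := norm_deriv_cutPhase_le hE y₀ (cutPhase_bound hE hC y₀) hψ
  have hmem : Set.Ioc (0 : ℝ) 1 ∈ nhdsWithin (0 : ℝ) (Set.Ioi 0) :=
    Ioc_mem_nhdsGT zero_lt_one
  have h0 : Tendsto (fun ε => cutPhase E y₀ ψ ε 0) (nhdsWithin 0 (Set.Ioi 0))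
      (nhds (((2 * Real.pi) ^ n * ψ 0) • (1 : B))) := by
    have := (tendsto_integral_cutoff hψ y₀).smul_const (1 : B)
    simp only [← cutPhase_zero (E := E)] at this
    convert this using 2
    rw [← Complex.coe_smul]
    push_cast
    rfl
  have hdiff : Tendsto (fun ε => cutPhase E y₀ ψ ε 1 - cutPhase E y₀ ψ ε 0)
      (nhdsWithin 0 (Set.Ioi 0)) (nhds 0) := by
    refine squeeze_zero_norm' (a := fun ε => ε * (D * (ε⁻¹) ^ 0)) ?_ ?_
    · filter_upwards [hmem] with ε hε using hD ε hε 1 ⟨zero_le_one, le_rfl⟩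
    · have : Tendsto (fun ε : ℝ => ε * D) (nhds 0) (nhds (0 * D)) :=
        (continuous_id.mul continuous_const).tendsto 0
      simpa using this.mono_left nhdsWithin_le_nhds
  have h1 : Tendsto (fun ε => cutPhase E y₀ ψ ε 1) (nhdsWithin 0 (Set.Ioi 0))
      (nhds (((2 * Real.pi) ^ n * ψ 0) • (1 : B))) := by
    simpa using hdiff.add h0
  have h2 := h1.mul_const (exp (Complex.I • ∑ j, E (Pi.single j 1, 0) * E (0, Pi.single j 1)))
  rw [smul_mul_assoc, one_mul] at h2
  refine h2.congr' ?_
  filter_upwards [hmem] with ε hε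
  unfold cutPhase
  rw [← integral_mul_const_of_integrable
    ((hψ.comp_affine y₀ hε.1).integrable_smul (continuous_shiftedPhase_right 1))]
  congr 1
  ext y
  have hsq : Complex.I • ∑ j, E (Pi.single j 1, 0) * E (0, Pi.single j 1) = -squareTerm E := by
    rw [squareTerm, neg_neg]
  rw [hsq, shiftedPhase, smul_mul_assoc, smul_mul_assoc, ← exp_add_of_commute_complex]
  · simp
  · simp only [one_smul, one_pow]
    exact ((commute_squareTerm hE y).add_left (Commute.refl _)).neg_right

end CoreLimit

section Generator

open NormedSpace (exp)

/-- The product rule for a complex bilinear map and curves with a real parameter. -/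
theorem HasDerivAt.complex_bilinear {V W Z : Type*} [NormedAddCommGroup V] [NormedSpace ℂ V]
    [NormedAddCommGroup W] [NormedSpace ℂ W] [NormedAddCommGroup Z] [NormedSpace ℂ Z]
    (J : V →L[ℂ] W →L[ℂ] Z) {k : ℝ → V} {l : ℝ → W} {k' : V} {l' : W} {t : ℝ}
    (hk : HasDerivAt k k' t) (hl : HasDerivAt l l' t) :
    HasDerivAt (fun s => J (k s) (l s)) (J k' (l t) + J (k t) l') t := by
  rw [add_comm]
  exact (J.bilinearRestrictScalars ℝ).hasDerivAt_of_bilinear (fun _ => hk) (fun _ => hl)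

theorem HasDerivAt.complex_clm {V W : Type*} [NormedAddCommGroup V] [NormedSpace ℂ V]
    [NormedAddCommGroup W] [NormedSpace ℂ W] (J : V →L[ℂ] W) {k : ℝ → V} {k' : V} {t : ℝ}
    (hk : HasDerivAt k k' t) : HasDerivAt (fun s => J (k s)) (J k') t :=
  (J.restrictScalars ℝ).hasFDerivAt.comp_hasDerivAt t hk

theorem HasDerivAt.complex_clm_apply {V W : Type*} [NormedAddCommGroup V] [NormedSpace ℂ V]
    [NormedAddCommGroup W] [NormedSpace ℂ W] {k : ℝ → V →L[ℂ] W} {k' : V →L[ℂ] W} {t : ℝ}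
    (hk : HasDerivAt k k' t) (v : V) : HasDerivAt (fun s => k s v) (k' v) t :=
  hk.complex_clm (ContinuousLinearMap.apply ℂ W v)

/-- The solution of an autonomous linear differential equation is given by the exponential. -/
theorem eq_exp_of_hasDerivAt {V : Type*} [NormedAddCommGroup V] [NormedSpace ℂ V]
    [CompleteSpace V] {R : V →L[ℂ] V} {f : ℝ → V} (hf : ∀ t, HasDerivAt f (R (f t)) t) (t : ℝ) :
    f t = exp (t • R) (f 0) := by
  have hg : ∀ s : ℝ, HasDerivAt (fun s : ℝ => exp (s • (-R)) (f s)) 0 s := fun s => by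
    have h := (hasDerivAt_exp_smul_const (-R) s).complex_bilinear (ContinuousLinearMap.id ℂ _)
      (hf s)
    refine h.congr_deriv ?_
    simp
  have h := is_const_of_deriv_eq_zero (fun s => (hg s).differentiableAt) (fun s => (hg s).deriv) t 0
  simp only [zero_smul, NormedSpace.exp_zero, one_apply_eq_self] at h
  rw [← h, ← mul_apply_eq_comp, ← exp_add_of_commute_complex]
  · simp
  · exact ((Commute.refl R).neg_right.smul_left _).smul_right _

variable {n : ℕ} {A : Type*} [NormedAddCommGroup A] [NormedSpace ℂ A]

/-- A strongly smooth representation of the additive group `ℝⁿ`. -/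
structure IsSmoothAction (α : (Fin n → ℝ) → A →L[ℂ] A) : Prop where
  map_zero : α 0 = 1
  map_add : ∀ x y, α (x + y) = α x * α y
  smooth : ∀ a, ContDiff ℝ ∞ fun x => α x a

variable [CompleteSpace A] {α : (Fin n → ℝ) → A →L[ℂ] A}

omit [CompleteSpace A] in
theorem IsSmoothAction.hasDerivAt_zero (h : IsSmoothAction α) (v : Fin n → ℝ) (a : A) :
    HasDerivAt (fun s : ℝ => α (s • v) a) (fderiv ℝ (fun x => α x a) 0 v) 0 := by
  have h1 : HasFDerivAt (fun x => α x a) (fderiv ℝ (fun x => α x a) 0) ((0 : ℝ) • v) := by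
    rw [zero_smul]
    exact ((h.smooth a).differentiable (by simp) 0).hasFDerivAt
  have h2 : HasDerivAt (fun s : ℝ => s • v) v 0 := by
    simpa using (hasDerivAt_id (0 : ℝ)).smul_const v
  exact h1.comp_hasDerivAt 0 h2

theorem IsSmoothAction.exists_generator (h : IsSmoothAction α) :
    ∃ D : (Fin n → ℝ) →ₗ[ℝ] A →L[ℂ] A, ∀ v a, D v a = fderiv ℝ (fun x => α x a) 0 v := by
  have hD : ∀ v : Fin n → ℝ, ∃ d : A →L[ℂ] A, ∀ a, d a = fderiv ℝ (fun x => α x a) 0 v := by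
    intro v
    refine ⟨continuousLinearMapOfTendsto (l := nhdsWithin (0 : ℝ) {0}ᶜ)
      (fun s : ℝ => (s⁻¹ : ℂ) • (α (s • v) - 1))
      (f := fun a => fderiv ℝ (fun x => α x a) 0 v) (tendsto_pi_nhds.2 fun a => ?_), fun a => rfl⟩
    refine ((h.hasDerivAt_zero v a).tendsto_slope_zero).congr fun s => ?_
    simp only [zero_add, zero_smul, h.map_zero, smul_apply,
      sub_apply, ← Complex.ofReal_inv, Complex.coe_smul]
  choose d hd using hD
  refine ⟨⟨⟨d, fun u v => ?_⟩, fun c v => ?_⟩, hd⟩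
  · ext a
    simp [hd]
  · ext a
    simp [hd]

/-- The infinitesimal generator of a smooth action. -/
noncomputable def IsSmoothAction.gen (h : IsSmoothAction α) : (Fin n → ℝ) →ₗ[ℝ] A →L[ℂ] A :=
  h.exists_generator.choose

namespace IsSmoothAction

theorem hasDerivAt_gen (h : IsSmoothAction α) (v : Fin n → ℝ) (a : A) :
    HasDerivAt (fun s : ℝ => α (s • v) a) (h.gen v a) 0 := by
  rw [gen, h.exists_generator.choose_spec]
  exact h.hasDerivAt_zero v a

omit [CompleteSpace A] in
theorem commute (h : IsSmoothAction α) (x y : Fin n → ℝ) : Commute (α x) (α y) := by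
  rw [Commute, SemiconjBy, ← h.map_add, ← h.map_add, add_comm]

theorem commute_gen (h : IsSmoothAction α) (x v : Fin n → ℝ) : Commute (α x) (h.gen v) := by
  ext a
  have h1 := (h.hasDerivAt_gen v a).complex_clm (α x)
  have h2 := h.hasDerivAt_gen v (α x a)
  refine h1.unique (h2.congr_of_eventuallyEq (Eventually.of_forall fun s => ?_))
  exact DFunLike.congr_fun (h.commute x (s • v)).eq a

theorem gen_commute_gen (h : IsSmoothAction α) (u v : Fin n → ℝ) :
    Commute (h.gen u) (h.gen v) := by
  ext a
  have h1 := (h.hasDerivAt_gen u a).complex_clm (h.gen v)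
  have h2 := h.hasDerivAt_gen u (h.gen v a)
  refine h2.unique (h1.congr_of_eventuallyEq (Eventually.of_forall fun s => ?_))
  exact DFunLike.congr_fun (h.commute_gen (s • u) v).eq a

theorem hasDerivAt_line_apply (h : IsSmoothAction α) (x v : Fin n → ℝ) (a : A) (t : ℝ) :
    HasDerivAt (fun s : ℝ => α (x + s • v) a) (α (x + t • v) (h.gen v a)) t := by
  have h1 := (h.hasDerivAt_gen v a).complex_clm (α (x + t • v))
  rw [← sub_self t] at h1
  refine (h1.comp_sub_const t t).congr_of_eventuallyEq (Eventually.of_forall fun s => ?_)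
  simp only [← mul_apply_eq_comp, ← h.map_add]
  congr 2
  module

theorem apply_eq_exp (h : IsSmoothAction α) (x : Fin n → ℝ) : α x = exp (h.gen x) := by
  ext a
  have := eq_exp_of_hasDerivAt (R := h.gen x) (f := fun s : ℝ => α (0 + s • x) a) (fun t => ?_) 1
  · simpa [h.map_zero] using this
  · refine (h.hasDerivAt_line_apply 0 x a t).congr_deriv ?_
    exact DFunLike.congr_fun (h.commute_gen (0 + t • x) x).eq a

theorem hasDerivAt_smul (h : IsSmoothAction α) (x : Fin n → ℝ) (t : ℝ) :
    HasDerivAt (fun s : ℝ => α (s • x)) (α (t • x) * h.gen x) t := by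
  simp only [h.apply_eq_exp, map_smul]
  exact hasDerivAt_exp_smul_const (h.gen x) t

end IsSmoothAction

end Generator

section Bilinear

set_option synthInstance.maxHeartbeats 200000

open NormedSpace (exp)
open ContinuousLinearMap (compL)

/-- Continuous bilinear operations on `A`. -/
abbrev Bilin (A : Type*) [NormedAddCommGroup A] [NormedSpace ℂ A] := A →L[ℂ] A →L[ℂ] A

variable {A : Type*} [NormedAddCommGroup A] [NormedSpace ℂ A]

noncomputable instance : NormedAddCommGroup (Bilin A) := inferInstance

noncomputable instance : NormedSpace ℂ (Bilin A) := inferInstance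

noncomputable instance : NormedRing (Bilin A →L[ℂ] Bilin A) := inferInstance

noncomputable instance : NormedAlgebra ℂ (Bilin A →L[ℂ] Bilin A) := inferInstance

noncomputable instance : Ring (Bilin A →L[ℂ] Bilin A) := NormedRing.toRing

noncomputable instance : Norm (Bilin A →L[ℂ] Bilin A) := inferInstance

noncomputable instance : NormedSpace ℝ (Bilin A →L[ℂ] Bilin A) := inferInstance

noncomputable instance : Distrib (Bilin A →L[ℂ] Bilin A) := inferInstance

noncomputable instance : IsTopologicalRing (Bilin A →L[ℂ] Bilin A) := inferInstance

noncomputable instance : SMul ℝ (Bilin A →L[ℂ] Bilin A) := NormedSpace.toModule.toSMul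

/-- Precomposition of a bilinear operation with an operator in the first argument. -/
noncomputable def precompFst : (A →L[ℂ] A) →L[ℂ] Bilin A →L[ℂ] Bilin A :=
  (compL ℂ A A (A →L[ℂ] A)).flip

/-- Precomposition of a bilinear operation with an operator in the second argument. -/
noncomputable def precompSnd : (A →L[ℂ] A) →L[ℂ] Bilin A →L[ℂ] Bilin A :=
  (compL ℂ A (A →L[ℂ] A) (A →L[ℂ] A)).comp (compL ℂ A A A).flip

/-- Composition of an operator with a bilinear operation. -/
noncomputable def postcomp : (A →L[ℂ] A) →L[ℂ] Bilin A →L[ℂ] Bilin A :=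
  (compL ℂ A (A →L[ℂ] A) (A →L[ℂ] A)).comp (compL ℂ A A A)

@[simp]
theorem precompFst_apply (d : A →L[ℂ] A) (K : Bilin A) (a b : A) :
    precompFst d K a b = K (d a) b := rfl

@[simp]
theorem precompSnd_apply (d : A →L[ℂ] A) (K : Bilin A) (a b : A) :
    precompSnd d K a b = K a (d b) := rfl

@[simp]
theorem postcomp_apply (d : A →L[ℂ] A) (K : Bilin A) (a b : A) :
    postcomp d K a b = d (K a b) := rfl

theorem commute_precompFst {d e : A →L[ℂ] A} (h : Commute d e) :
    Commute (precompFst d) (precompFst e) := by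
  ext K a b
  exact congrArg (fun x => K x b) (DFunLike.congr_fun h.symm.eq a)

theorem commute_precompSnd {d e : A →L[ℂ] A} (h : Commute d e) :
    Commute (precompSnd d) (precompSnd e) := by
  ext K a b
  exact congrArg (fun x => K a x) (DFunLike.congr_fun h.symm.eq b)

theorem commute_precompFst_precompSnd (d e : A →L[ℂ] A) :
    Commute (precompFst d) (precompSnd e) := rfl

theorem commute_postcomp_precompFst (d e : A →L[ℂ] A) :
    Commute (postcomp d) (precompFst e) := rfl

theorem commute_postcomp_precompSnd (d e : A →L[ℂ] A) :
    Commute (postcomp d) (precompSnd e) := rfl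

variable {n : ℕ} [CompleteSpace A] {α : (Fin n → ℝ) → A →L[ℂ] A}

namespace IsSmoothAction

/-- The generator of the action `(p, x) • K = K (α (L₁ p) ·) (α (L₂ x) ·)` on bilinear
operations. -/
noncomputable def pairGen (h : IsSmoothAction α) (L₁ L₂ : (Fin n → ℝ) →ₗ[ℝ] Fin n → ℝ) :
    (Fin n → ℝ) × (Fin n → ℝ) →ₗ[ℝ] Bilin A →L[ℂ] Bilin A :=
  (precompFst.restrictScalars ℝ).toLinearMap ∘ₗ h.gen ∘ₗ L₁ ∘ₗ LinearMap.fst ℝ _ _ +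
    (precompSnd.restrictScalars ℝ).toLinearMap ∘ₗ h.gen ∘ₗ L₂ ∘ₗ LinearMap.snd ℝ _ _

variable (h : IsSmoothAction α) (L₁ L₂ : (Fin n → ℝ) →ₗ[ℝ] Fin n → ℝ)

theorem pairGen_apply (y : (Fin n → ℝ) × (Fin n → ℝ)) :
    h.pairGen L₁ L₂ y = precompFst (h.gen (L₁ y.1)) + precompSnd (h.gen (L₂ y.2)) := rfl

theorem commute_pairGen (u v : (Fin n → ℝ) × (Fin n → ℝ)) :
    Commute (h.pairGen L₁ L₂ u) (h.pairGen L₁ L₂ v) := by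
  simp only [pairGen_apply]
  exact ((commute_precompFst (h.gen_commute_gen _ _)).add_right
    (commute_precompFst_precompSnd _ _)).add_left
    ((commute_precompFst_precompSnd _ _).symm.add_right
      (commute_precompSnd (h.gen_commute_gen _ _)))

theorem exp_pairGen_apply (y : (Fin n → ℝ) × (Fin n → ℝ)) (K : Bilin A) (a b : A) :
    exp (h.pairGen L₁ L₂ y) K a b = K (α (L₁ y.1) a) (α (L₂ y.2) b) := by
  have := eq_exp_of_hasDerivAt (R := h.pairGen L₁ L₂ y)
    (f := fun s : ℝ => precompFst (α (s • L₁ y.1)) (precompSnd (α (s • L₂ y.2)) K))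
    (fun t => ?_) 1
  · have h2 := congrArg (fun K : Bilin A => K a b) this
    have h3 : precompFst (1 : A →L[ℂ] A) (precompSnd (1 : A →L[ℂ] A) K) = K := rfl
    simpa [h.map_zero, h3] using h2.symm
  · have h1 := (h.hasDerivAt_smul (L₁ y.1) t).complex_clm precompFst
    have h2 := ((h.hasDerivAt_smul (L₂ y.2) t).complex_clm precompSnd).complex_clm_apply K
    refine (h1.complex_bilinear (ContinuousLinearMap.id ℂ _) h2).congr_deriv ?_
    ext a b
    rfl

omit [CompleteSpace A] in
theorem norm_comp_linear_le {C : ℝ} {k : ℕ} (hC : ∀ x, ‖α x‖ ≤ C * (1 + ‖x‖) ^ k)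
    (L : (Fin n → ℝ) →ₗ[ℝ] Fin n → ℝ) :
    ∃ D, 0 ≤ D ∧ ∀ x, ‖α (L x)‖ ≤ D * (1 + ‖x‖) ^ k := by
  have hC0 : 0 ≤ C := by simpa using (norm_nonneg _).trans (hC 0)
  set c := ‖L.toContinuousLinearMap‖
  have hL : ∀ x, ‖L x‖ ≤ c * ‖x‖ := fun x => L.toContinuousLinearMap.le_opNorm x
  have hc : 0 ≤ c := norm_nonneg _
  refine ⟨C * (1 + c) ^ k, by positivity, fun x => (hC _).trans ?_⟩
  rw [mul_assoc, ← mul_pow]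
  gcongr
  nlinarith [hL x, norm_nonneg x]

theorem norm_exp_pairGen_le {C : ℝ} {k : ℕ} (hC : ∀ x, ‖α x‖ ≤ C * (1 + ‖x‖) ^ k) :
    ∃ (D : ℝ), ∀ y, ‖exp (h.pairGen L₁ L₂ y)‖ ≤ D * (1 + ‖y‖) ^ (k + k) := by
  obtain ⟨D₁, h₁, hD₁⟩ := norm_comp_linear_le hC L₁
  obtain ⟨D₂, h₂, hD₂⟩ := norm_comp_linear_le hC L₂
  refine ⟨D₁ * D₂, fun y => ContinuousLinearMap.opNorm_le_bound _ (by positivity) fun K => ?_⟩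
  refine ContinuousLinearMap.opNorm_le_bound₂ _ (by positivity) fun a b => ?_
  rw [exp_pairGen_apply]
  have h3 : ‖α (L₁ y.1)‖ ≤ D₁ * (1 + ‖y‖) ^ k := by
    refine (hD₁ _).trans ?_
    gcongr
    exact norm_fst_le y
  have h4 : ‖α (L₂ y.2)‖ ≤ D₂ * (1 + ‖y‖) ^ k := by
    refine (hD₂ _).trans ?_
    gcongr
    exact norm_snd_le y
  calc _ ≤ ‖K‖ * ‖α (L₁ y.1) a‖ * ‖α (L₂ y.2) b‖ := K.le_opNorm₂ _ _
    _ ≤ ‖K‖ * ((D₁ * (1 + ‖y‖) ^ k) * ‖a‖) * ((D₂ * (1 + ‖y‖) ^ k) * ‖b‖) := by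
      gcongr
      · exact ContinuousLinearMap.le_of_opNorm_le _ h3 a
      · exact ContinuousLinearMap.le_of_opNorm_le _ h4 b
    _ = _ := by ring

/-- The bidifferential operator `i ∑ⱼ ∂ⱼ ⊗ ∂ⱼ` acting on bilinear operations. -/
noncomputable def bidiff : Bilin A →L[ℂ] Bilin A :=
  Complex.I • ∑ j, precompFst (h.gen (L₁ (Pi.single j 1))) *
    precompSnd (h.gen (L₂ (Pi.single j 1)))

theorem bidiff_apply (K : Bilin A) (a b : A) : h.bidiff L₁ L₂ K a b =
    Complex.I • ∑ j, K (h.gen (L₁ (Pi.single j 1)) a) (h.gen (L₂ (Pi.single j 1)) b) := by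
  simp [bidiff]

/-- The bilinear operation obtained from `K` by the deformation with parameter `t`. -/
noncomputable def deform (K : Bilin A) (t : ℝ) : Bilin A := exp (t • h.bidiff L₁ L₂) K

theorem tendsto_integral_pairing {C : ℝ} {k : ℕ} (hC : ∀ x, ‖α x‖ ≤ C * (1 + ‖x‖) ^ k)
    (K : Bilin A) (a b : A) (y₀ : (Fin n → ℝ) × (Fin n → ℝ))
    {ψ : (Fin n → ℝ) × (Fin n → ℝ) → ℝ} (hψ : IsTest ψ) :
    Tendsto (fun ε : ℝ => ∫ y : (Fin n → ℝ) × (Fin n → ℝ), ψ (ε • (y - y₀)) •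
        (Complex.exp (Complex.I * (y.1 ⬝ᵥ y.2 : ℝ)) • K (α (L₁ y.1) a) (α (L₂ y.2) b)))
      (nhdsWithin 0 (Set.Ioi 0))
      (nhds (((2 * Real.pi) ^ n * ψ 0) • h.deform L₁ L₂ K 1 a b)) := by
  obtain ⟨D, hD⟩ := h.norm_exp_pairGen_le L₁ L₂ hC
  have h1 := tendsto_integral_exp (h.commute_pairGen L₁ L₂) hD y₀ hψ
  set ev : (Bilin A →L[ℂ] Bilin A) →L[ℂ] A :=
    (ContinuousLinearMap.apply ℂ A b).comp ((ContinuousLinearMap.apply ℂ (A →L[ℂ] A) a).comp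
      (ContinuousLinearMap.apply ℂ (Bilin A) K)) with hev
  have hev' : ∀ T, ev T = T K a b := fun T => rfl
  have h2 := (ev.continuous.tendsto _).comp h1
  have hR : Complex.I • ∑ j, h.pairGen L₁ L₂ (Pi.single j 1, 0) *
      h.pairGen L₁ L₂ (0, Pi.single j 1) = h.bidiff L₁ L₂ := by
    simp [pairGen_apply, bidiff]
  rw [hR] at h2
  have h3 : ev (((2 * Real.pi) ^ n * ψ 0) • exp (h.bidiff L₁ L₂)) =
      ((2 * Real.pi) ^ n * ψ 0) • h.deform L₁ L₂ K 1 a b := by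
    rw [hev', deform, one_smul]
    rfl
  rw [h3] at h2
  refine h2.congr' ?_
  filter_upwards [self_mem_nhdsWithin] with ε hε
  have hcont : Continuous fun y : (Fin n → ℝ) × (Fin n → ℝ) =>
      Complex.exp (Complex.I * (y.1 ⬝ᵥ y.2 : ℝ)) • exp (h.pairGen L₁ L₂ y) :=
    continuous_cexp_dotProduct.smul
      (continuous_exp_complex.comp (h.pairGen L₁ L₂).continuous_of_finiteDimensional)
  rw [Function.comp_apply, ← ContinuousLinearMap.integral_comp_comm _
    ((hψ.comp_affine y₀ hε).integrable_smul hcont)]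
  refine integral_congr_ae (Eventually.of_forall fun y => ?_)
  simp only [hev', ← exp_pairGen_apply h L₁ L₂]
  rfl

end IsSmoothAction

end Bilinear

section Associativity

set_option synthInstance.maxHeartbeats 200000

open NormedSpace (exp)
open ContinuousLinearMap (compL)

variable {A : Type*} [NormedAddCommGroup A] [NormedSpace ℂ A]

noncomputable instance : NormedAddCommGroup (A →L[ℂ] Bilin A) := inferInstance

noncomputable instance : NormedSpace ℂ (A →L[ℂ] Bilin A) := inferInstance

noncomputable instance : NormedSpace ℝ (A →L[ℂ] Bilin A) := NormedSpace.complexToReal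

noncomputable instance : Module ℝ (A →L[ℂ] Bilin A) := NormedSpace.toModule

/-- The trilinear operation `(a, b, c) ↦ K (L a b) c`. -/
noncomputable def bracketLeft : Bilin A →L[ℂ] Bilin A →L[ℂ] A →L[ℂ] Bilin A :=
  (compL ℂ A (A →L[ℂ] A) (Bilin A)).comp (compL ℂ A A (A →L[ℂ] A))

/-- The trilinear operation `(a, b, c) ↦ K a (L b c)`, as a function of `L` and `K`. -/
noncomputable def bracketRight : Bilin A →L[ℂ] Bilin A →L[ℂ] A →L[ℂ] Bilin A :=
  (compL ℂ A (A →L[ℂ] A) (Bilin A)).comp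
    (((compL ℂ (A →L[ℂ] A) ((A →L[ℂ] A) →L[ℂ] A →L[ℂ] A) (Bilin A)).flip (compL ℂ A A A)).comp
      (compL ℂ A (A →L[ℂ] A) (A →L[ℂ] A)).flip)

@[simp]
theorem bracketLeft_apply (K L : Bilin A) (a b c : A) :
    bracketLeft K L a b c = K (L a b) c := rfl

@[simp]
theorem bracketRight_apply (K L : Bilin A) (a b c : A) :
    bracketRight L K a b c = K a (L b c) := rfl

variable {n : ℕ} [CompleteSpace A] {α : (Fin n → ℝ) → A →L[ℂ] A}

namespace IsSmoothAction

variable (h : IsSmoothAction α) (L₁ L₂ : (Fin n → ℝ) →ₗ[ℝ] Fin n → ℝ)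

theorem deform_zero (K : Bilin A) : h.deform L₁ L₂ K 0 = K := by
  simp [deform]

theorem hasDerivAt_deform (K : Bilin A) (t : ℝ) :
    HasDerivAt (h.deform L₁ L₂ K) (h.bidiff L₁ L₂ (h.deform L₁ L₂ K t)) t :=
  (hasDerivAt_exp_smul_const' (h.bidiff L₁ L₂) t).complex_clm_apply K

theorem commute_bidiff {Q : Bilin A →L[ℂ] Bilin A} (h₁ : ∀ v, Commute Q (precompFst (h.gen v)))
    (h₂ : ∀ v, Commute Q (precompSnd (h.gen v))) : Commute Q (h.bidiff L₁ L₂) :=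
  (Commute.sum_right _ _ _ fun _ _ => (h₁ _).mul_right (h₂ _)).smul_right _

theorem gen_deform {K : Bilin A} (hK : ∀ v a b, h.gen v (K a b) = K (h.gen v a) b + K a (h.gen v b))
    (t : ℝ) (v : Fin n → ℝ) (a b : A) : h.gen v (h.deform L₁ L₂ K t a b) =
      h.deform L₁ L₂ K t (h.gen v a) b + h.deform L₁ L₂ K t a (h.gen v b) := by
  set Q : Bilin A →L[ℂ] Bilin A :=
    postcomp (h.gen v) - (precompFst (h.gen v) + precompSnd (h.gen v)) with hQ
  have hQc : Commute Q (h.bidiff L₁ L₂) := by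
    refine h.commute_bidiff L₁ L₂ (fun u => ?_) fun u => ?_
    · exact (commute_postcomp_precompFst _ _).sub_left
        ((commute_precompFst (h.gen_commute_gen _ _)).add_left
          (commute_precompFst_precompSnd _ _).symm)
    · exact (commute_postcomp_precompSnd _ _).sub_left
        ((commute_precompFst_precompSnd _ _).add_left
          (commute_precompSnd (h.gen_commute_gen _ _)))
  have hQK : Q K = 0 := by
    ext a b
    simp [hQ, hK]
  have h1 : Q (h.deform L₁ L₂ K t) = 0 := by
    have h2 := DFunLike.congr_fun ((hQc.smul_right t).exp_right).eq K
    rw [mul_apply_eq_comp, mul_apply_eq_comp, hQK, _root_.map_zero] at h2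
    exact h2
  have h3 := congrArg (fun K : Bilin A => K a b) h1
  exact sub_eq_zero.1 h3

/-- The generator of the evolution of the associator. -/
noncomputable def tridiff : (A →L[ℂ] Bilin A) →L[ℂ] A →L[ℂ] Bilin A :=
  Complex.I • ∑ j,
    ((compL ℂ A A (Bilin A)).flip (h.gen (L₁ (Pi.single j 1))) ∘L
        compL ℂ A (Bilin A) (Bilin A) (precompFst (h.gen (L₂ (Pi.single j 1)))) +
      (compL ℂ A A (Bilin A)).flip (h.gen (L₁ (Pi.single j 1))) ∘L
        compL ℂ A (Bilin A) (Bilin A) (precompSnd (h.gen (L₂ (Pi.single j 1)))) +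
      compL ℂ A (Bilin A) (Bilin A) (precompFst (h.gen (L₁ (Pi.single j 1)))) ∘L
        compL ℂ A (Bilin A) (Bilin A) (precompSnd (h.gen (L₂ (Pi.single j 1)))))

theorem tridiff_apply (f : A →L[ℂ] Bilin A) (a b c : A) : h.tridiff L₁ L₂ f a b c =
    Complex.I • ∑ j, (f (h.gen (L₁ (Pi.single j 1)) a) (h.gen (L₂ (Pi.single j 1)) b) c +
      f (h.gen (L₁ (Pi.single j 1)) a) b (h.gen (L₂ (Pi.single j 1)) c) +
      f a (h.gen (L₁ (Pi.single j 1)) b) (h.gen (L₂ (Pi.single j 1)) c)) := by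
  simp [tridiff]

theorem tridiff_bracketLeft {K : Bilin A}
    (hK : ∀ v a b, h.gen v (K a b) = K (h.gen v a) b + K a (h.gen v b)) :
    h.tridiff L₁ L₂ (bracketLeft K K) =
      bracketLeft (h.bidiff L₁ L₂ K) K + bracketLeft K (h.bidiff L₁ L₂ K) := by
  ext a b c
  rw [tridiff_apply, add_apply, add_apply, add_apply]
  simp only [bracketLeft_apply, bidiff_apply, hK, map_smul, map_sum, _root_.map_add, add_apply,
    smul_apply, sum_apply, Finset.sum_add_distrib, smul_add]
  abel

theorem tridiff_bracketRight {K : Bilin A}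
    (hK : ∀ v a b, h.gen v (K a b) = K (h.gen v a) b + K a (h.gen v b)) :
    h.tridiff L₁ L₂ (bracketRight K K) =
      bracketRight (h.bidiff L₁ L₂ K) K + bracketRight K (h.bidiff L₁ L₂ K) := by
  ext a b c
  rw [tridiff_apply, add_apply, add_apply, add_apply]
  simp only [bracketRight_apply, bidiff_apply, hK, map_smul, map_sum, _root_.map_add,
    Finset.sum_add_distrib, smul_add]
  abel

theorem deform_assoc {K : Bilin A} (hK : ∀ v a b, h.gen v (K a b) = K (h.gen v a) b + K a (h.gen v b))
    (hassoc : ∀ a b c, K (K a b) c = K a (K b c)) (t : ℝ) (a b c : A) :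
    h.deform L₁ L₂ K t (h.deform L₁ L₂ K t a b) c =
      h.deform L₁ L₂ K t a (h.deform L₁ L₂ K t b c) := by
  have hk0 := h.deform_zero L₁ L₂ K
  have hkd := h.hasDerivAt_deform L₁ L₂ K
  have hg := h.gen_deform L₁ L₂ hK
  generalize h.deform L₁ L₂ K = k at hk0 hkd hg ⊢
  have hl := fun t => (hkd t).complex_bilinear bracketLeft (hkd t)
  have hr := fun t => (hkd t).complex_bilinear bracketRight (hkd t)
  have hd : ∀ t, HasDerivAt (fun s => bracketLeft (k s) (k s) - bracketRight (k s) (k s))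
      (h.tridiff L₁ L₂ (bracketLeft (k t) (k t) - bracketRight (k t) (k t))) t := by
    intro t
    rw [_root_.map_sub, tridiff_bracketLeft h L₁ L₂ (hg t), tridiff_bracketRight h L₁ L₂ (hg t)]
    exact (hl t).sub (hr t)
  have h0 := eq_exp_of_hasDerivAt hd t
  have h00 : bracketLeft (k 0) (k 0) - bracketRight (k 0) (k 0) = 0 := by
    ext a b c
    simp [hk0, hassoc]
  simp only [h00, _root_.map_zero] at h0
  have h3 := congrArg (fun f : A →L[ℂ] Bilin A => f a b c) h0
  exact sub_eq_zero.1 h3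

end IsSmoothAction

end Associativity

section Symbols

theorem contDiff_fstHalf {n : ℕ} : ContDiff ℝ ∞ (fstHalf : (Fin (n + n) → ℝ) → Fin n → ℝ) :=
  contDiff_pi.2 fun _ => contDiff_apply _ _ _

theorem contDiff_sndHalf {n : ℕ} : ContDiff ℝ ∞ (sndHalf : (Fin (n + n) → ℝ) → Fin n → ℝ) :=
  contDiff_pi.2 fun _ => contDiff_apply _ _ _

theorem norm_fstHalf_le {n : ℕ} (z : Fin (n + n) → ℝ) : ‖fstHalf z‖ ≤ ‖z‖ :=
  (pi_norm_le_iff_of_nonneg (norm_nonneg z)).2 fun _ => norm_le_pi_norm z _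

theorem norm_sndHalf_le {n : ℕ} (z : Fin (n + n) → ℝ) : ‖sndHalf z‖ ≤ ‖z‖ :=
  (pi_norm_le_iff_of_nonneg (norm_nonneg z)).2 fun _ => norm_le_pi_norm z _

theorem mder_zero {n : ℕ} {V : Type*} [NormedAddCommGroup V] [NormedSpace ℝ V]
    (f : (Fin n → ℝ) → V) : mder 0 f = f := by
  unfold mder
  induction List.finRange n with
  | nil => rfl
  | cons i l _ => simp

/-- A family of functions closed under partial derivatives is closed under `mder`. -/
theorem mder_mem {n : ℕ} {V : Type*} [NormedAddCommGroup V] [NormedSpace ℝ V]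
    {S : Set ((Fin n → ℝ) → V)} (hS : ∀ i, ∀ f ∈ S, pder i f ∈ S) (μ : Fin n → ℕ)
    {f : (Fin n → ℝ) → V} (hf : f ∈ S) : mder μ f ∈ S := by
  unfold mder
  induction List.finRange n with
  | nil => exact hf
  | cons i l ih =>
    rw [List.foldr_cons]
    generalize μ i = k
    induction k with
    | zero => exact ih
    | succ k ihk =>
      rw [Function.iterate_succ_apply']
      exact hS i _ ihk

variable {n : ℕ} {A : Type*} [NormedAddCommGroup A] [NormedSpace ℂ A] [CompleteSpace A]
  {α : (Fin n → ℝ) → A →L[ℂ] A}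

namespace IsSmoothAction

variable (h : IsSmoothAction α)
include h

theorem gen_mul {K : A →L[ℂ] A →L[ℂ] A} (hK : ∀ x a b, α x (K a b) = K (α x a) (α x b))
    (v : Fin n → ℝ) (a b : A) : h.gen v (K a b) = K (h.gen v a) b + K a (h.gen v b) := by
  have h1 := (h.hasDerivAt_gen v a).complex_bilinear K (h.hasDerivAt_gen v b)
  simp only [← hK, zero_smul, h.map_zero, one_apply_eq_self] at h1
  exact (h.hasDerivAt_gen v _).unique h1

omit [CompleteSpace A] in
theorem contDiff_pairing (θ : Matrix (Fin n) (Fin n) ℝ) (K : A →L[ℂ] A →L[ℂ] A) (a b : A) :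
    ContDiff ℝ ∞ fun z : Fin (n + n) → ℝ =>
      K (α (θ.mulVec (fstHalf z)) a) (α (sndHalf z) b) := by
  have h1 : ContDiff ℝ ∞ fun z : Fin (n + n) → ℝ => α (θ.mulVec (fstHalf z)) a :=
    (h.smooth a).comp ((θ.mulVecLin.toContinuousLinearMap.contDiff).comp contDiff_fstHalf)
  have h2 : ContDiff ℝ ∞ fun z : Fin (n + n) → ℝ => α (sndHalf z) b :=
    (h.smooth b).comp contDiff_sndHalf
  exact (K.bilinearRestrictScalars ℝ).isBoundedBilinearMap.contDiff.comp (h1.prodMk h2)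

theorem fderiv_pairing (θ : Matrix (Fin n) (Fin n) ℝ) (K : A →L[ℂ] A →L[ℂ] A) (a b : A)
    (z v : Fin (n + n) → ℝ) :
    fderiv ℝ (fun z : Fin (n + n) → ℝ => K (α (θ.mulVec (fstHalf z)) a) (α (sndHalf z) b)) z v =
      K (α (θ.mulVec (fstHalf z)) (h.gen (θ.mulVec (fstHalf v)) a)) (α (sndHalf z) b) +
      K (α (θ.mulVec (fstHalf z)) a) (α (sndHalf z) (h.gen (sndHalf v) b)) := by
  have hd := ((h.contDiff_pairing θ K a b).differentiable (by simp) z)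
  rw [← hd.lineDeriv_eq_fderiv]
  refine HasLineDerivAt.lineDeriv ?_
  unfold HasLineDerivAt
  have h1 := (h.hasDerivAt_line_apply (θ.mulVec (fstHalf z)) (θ.mulVec (fstHalf v)) a
    0).complex_bilinear K (h.hasDerivAt_line_apply (sndHalf z) (sndHalf v) b 0)
  simp only [zero_smul, add_zero] at h1
  refine h1.congr_of_eventuallyEq (Eventually.of_forall fun s => ?_)
  have e1 : fstHalf (z + s • v) = fstHalf z + s • fstHalf v := rfl
  have e2 : sndHalf (z + s • v) = sndHalf z + s • sndHalf v := rfl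
  simp only [e1, e2, Matrix.mulVec_add, Matrix.mulVec_smul]

theorem pder_pairing (θ : Matrix (Fin n) (Fin n) ℝ) (K : A →L[ℂ] A →L[ℂ] A) (i : Fin (n + n))
    (a b : A) : ∃ a' b' : A,
      pder i (fun z : Fin (n + n) → ℝ => K (α (θ.mulVec (fstHalf z)) a) (α (sndHalf z) b)) =
        fun z : Fin (n + n) → ℝ => K (α (θ.mulVec (fstHalf z)) a') (α (sndHalf z) b') := by
  unfold pder
  simp only [h.fderiv_pairing]
  refine Fin.addCases (fun j => ?_) (fun j => ?_) i
  · refine ⟨h.gen (θ.mulVec (fstHalf (Pi.single (Fin.castAdd n j) 1))) a, b, funext fun z => ?_⟩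
    have : sndHalf (Pi.single (Fin.castAdd n j) (1 : ℝ)) = 0 := by
      ext k
      simp [sndHalf, Pi.single_apply, Fin.ext_iff]
      omega
    simp [this]
  · refine ⟨a, h.gen (sndHalf (Pi.single (Fin.natAdd n j) 1)) b, funext fun z => ?_⟩
    have : fstHalf (Pi.single (Fin.natAdd n j) (1 : ℝ)) = 0 := by
      ext k
      simp [fstHalf, Pi.single_apply, Fin.ext_iff]
      omega
    simp only [this, Matrix.mulVec_zero, _root_.map_zero, zero_apply, zero_add]

theorem isSymbol_pairing {m C : ℝ} (hm : 0 ≤ m)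
    (hC : ∀ x a, ‖α x a‖ ≤ C * (1 + ‖x‖ ^ 2) ^ (m / 2) * ‖a‖)
    (θ : Matrix (Fin n) (Fin n) ℝ) (K : A →L[ℂ] A →L[ℂ] A) (a b : A) :
    IsSymbol (2 * m) 0 fun z : Fin (n + n) → ℝ =>
      K (α (θ.mulVec (fstHalf z)) a) (α (sndHalf z) b) := by
  refine ⟨h.contDiff_pairing θ K a b, fun μ => ?_⟩
  obtain ⟨⟨a', b'⟩, hab⟩ := mder_mem (S := Set.range fun ab : A × A =>
    fun z : Fin (n + n) → ℝ => K (α (θ.mulVec (fstHalf z)) ab.1) (α (sndHalf z) ab.2))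
    (by
      rintro i _ ⟨⟨a, b⟩, rfl⟩
      obtain ⟨a', b', h'⟩ := h.pder_pairing θ K i a b
      exact ⟨(a', b'), h'.symm⟩) μ ⟨(a, b), rfl⟩
  simp only at hab
  rw [← hab]
  set c := ‖θ.mulVecLin.toContinuousLinearMap‖
  have hC0 : 0 ≤ C * ‖a'‖ := by simpa using (norm_nonneg _).trans (hC 0 a')
  have hC0' : 0 ≤ C * ‖b'‖ := by simpa using (norm_nonneg _).trans (hC 0 b')
  refine ⟨‖K‖ * ((C * ‖a'‖) * (1 + c ^ 2) ^ (m / 2)) * (C * ‖b'‖), fun z => ?_⟩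
  have hz : 0 < 1 + ‖z‖ ^ 2 := by positivity
  have h1 : ‖α (θ.mulVec (fstHalf z)) a'‖ ≤
      ((C * ‖a'‖) * (1 + c ^ 2) ^ (m / 2)) * (1 + ‖z‖ ^ 2) ^ (m / 2) := by
    have h2 : ‖θ.mulVec (fstHalf z)‖ ≤ c * ‖z‖ :=
      (θ.mulVecLin.toContinuousLinearMap.le_opNorm _).trans
        (mul_le_mul_of_nonneg_left (norm_fstHalf_le z) (norm_nonneg _))
    have h3 : 1 + ‖θ.mulVec (fstHalf z)‖ ^ 2 ≤ (1 + c ^ 2) * (1 + ‖z‖ ^ 2) := by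
      have := pow_le_pow_left₀ (norm_nonneg _) h2 2
      nlinarith [sq_nonneg c, sq_nonneg ‖z‖]
    calc _ ≤ (C * ‖a'‖) * (1 + ‖θ.mulVec (fstHalf z)‖ ^ 2) ^ (m / 2) := by
          refine (hC _ _).trans (le_of_eq ?_)
          ring
      _ ≤ (C * ‖a'‖) * ((1 + c ^ 2) * (1 + ‖z‖ ^ 2)) ^ (m / 2) := by gcongr
      _ = _ := by
        rw [Real.mul_rpow (by positivity) hz.le]
        ring
  have h2 : ‖α (sndHalf z) b'‖ ≤ (C * ‖b'‖) * (1 + ‖z‖ ^ 2) ^ (m / 2) := by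
    calc _ ≤ (C * ‖b'‖) * (1 + ‖sndHalf z‖ ^ 2) ^ (m / 2) := by
          refine (hC _ _).trans (le_of_eq ?_)
          ring
      _ ≤ _ := by
        gcongr
        exact norm_sndHalf_le z
  have h3 : symWt (2 * m) 0 μ z * ((1 + ‖z‖ ^ 2) ^ (m / 2) * (1 + ‖z‖ ^ 2) ^ (m / 2)) = 1 := by
    unfold symWt
    rw [← Real.rpow_add hz, ← Real.rpow_add hz]
    convert Real.rpow_zero (1 + ‖z‖ ^ 2) using 2
    ring
  have h4 : 0 ≤ symWt (2 * m) 0 μ z := Real.rpow_nonneg hz.le _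
  calc _ ≤ symWt (2 * m) 0 μ z * (‖K‖ * (((C * ‖a'‖) * (1 + c ^ 2) ^ (m / 2)) *
          (1 + ‖z‖ ^ 2) ^ (m / 2)) * ((C * ‖b'‖) * (1 + ‖z‖ ^ 2) ^ (m / 2))) := by
        refine mul_le_mul_of_nonneg_left ((K.le_opNorm₂ _ _).trans ?_) h4
        gcongr
    _ = ‖K‖ * ((C * ‖a'‖) * (1 + c ^ 2) ^ (m / 2)) * (C * ‖b'‖) * (symWt (2 * m) 0 μ z *
          ((1 + ‖z‖ ^ 2) ^ (m / 2) * (1 + ‖z‖ ^ 2) ^ (m / 2))) := by ring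
    _ = _ := by rw [h3, mul_one]

end IsSmoothAction

omit [CompleteSpace A] in
theorem norm_le_pow_of_rpow {V : Type*} [NormedAddCommGroup V] {m C : ℝ} (hC0 : 0 ≤ C)
    {β : V → A →L[ℂ] A} (hC : ∀ x a, ‖β x a‖ ≤ C * (1 + ‖x‖ ^ 2) ^ (m / 2) * ‖a‖) (x : V) :
    ‖β x‖ ≤ C * (1 + ‖x‖) ^ ⌈m⌉₊ := by
  have h1 : 1 ≤ 1 + ‖x‖ := by linarith [norm_nonneg x]
  refine ContinuousLinearMap.opNorm_le_bound _ (by positivity) fun a => (hC x a).trans ?_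
  gcongr
  rcases le_total 0 m with hm | hm
  · calc (1 + ‖x‖ ^ 2) ^ (m / 2) ≤ ((1 + ‖x‖) ^ 2) ^ (m / 2) := by
          gcongr
          nlinarith [norm_nonneg x]
      _ = (1 + ‖x‖) ^ m := by
          rw [← Real.rpow_natCast, ← Real.rpow_mul (by positivity)]
          congr 1
          push_cast
          ring
      _ ≤ (1 + ‖x‖) ^ (⌈m⌉₊ : ℝ) := Real.rpow_le_rpow_of_exponent_le h1 (Nat.le_ceil m)
      _ = _ := Real.rpow_natCast _ _
  · rw [Nat.ceil_eq_zero.2 hm, pow_zero]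
    exact Real.rpow_le_one_of_one_le_of_nonpos (by linarith [sq_nonneg ‖x‖]) (by linarith)

end Symbols

section ChangeOfVariables

variable {n : ℕ}

/-- The linear coordinates on `ℝ²ⁿ` in which the pairing given by `M` is the dot product. -/
noncomputable def phaseEquiv (M : Matrix (Fin n) (Fin n) ℝ) (hM : IsUnit M.det) :
    ((Fin n → ℝ) × (Fin n → ℝ)) ≃L[ℝ] (Fin (n + n) → ℝ) :=
  LinearEquiv.toContinuousLinearEquiv
    { toFun := fun y => Fin.append y.1 (M⁻¹.mulVec y.2)
      invFun := fun z => (fstHalf z, M.mulVec (sndHalf z))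
      map_add' := fun y y' => by
        ext i
        refine Fin.addCases (fun j => ?_) (fun j => ?_) i <;>
          simp [Matrix.mulVec_add, -Fin.natAdd_eq_addNat]
      map_smul' := fun c y => by
        ext i
        refine Fin.addCases (fun j => ?_) (fun j => ?_) i <;>
          simp [Matrix.mulVec_smul, -Fin.natAdd_eq_addNat]
      left_inv := fun y => by
        have h1 : fstHalf (Fin.append y.1 (M⁻¹.mulVec y.2)) = y.1 :=
          funext fun i => Fin.append_left _ _ i
        have h2 : sndHalf (Fin.append y.1 (M⁻¹.mulVec y.2)) = M⁻¹.mulVec y.2 :=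
          funext fun i => Fin.append_right _ _ i
        simp only [h1, h2, Matrix.mulVec_mulVec, Matrix.mul_nonsing_inv M hM, Matrix.one_mulVec]
      right_inv := fun z => by
        ext i
        simp only [Matrix.mulVec_mulVec, Matrix.nonsing_inv_mul M hM, Matrix.one_mulVec]
        refine Fin.addCases (fun j => ?_) (fun j => ?_) i <;>
          simp [fstHalf, sndHalf, -Fin.natAdd_eq_addNat] }

variable (M : Matrix (Fin n) (Fin n) ℝ) (hM : IsUnit M.det)

theorem phaseEquiv_apply (y : (Fin n → ℝ) × (Fin n → ℝ)) :
    phaseEquiv M hM y = Fin.append y.1 (M⁻¹.mulVec y.2) := rfl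

theorem fstHalf_phaseEquiv (y : (Fin n → ℝ) × (Fin n → ℝ)) :
    fstHalf (phaseEquiv M hM y) = y.1 :=
  funext fun i => Fin.append_left _ _ i

theorem sndHalf_phaseEquiv (y : (Fin n → ℝ) × (Fin n → ℝ)) :
    sndHalf (phaseEquiv M hM y) = M⁻¹.mulVec y.2 :=
  funext fun i => Fin.append_right _ _ i

theorem phase_phaseEquiv (y : (Fin n → ℝ) × (Fin n → ℝ)) :
    phase M (phaseEquiv M hM y) = Complex.exp (Complex.I * (y.1 ⬝ᵥ y.2 : ℝ)) := by
  unfold phase pairM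
  rw [fstHalf_phaseEquiv, sndHalf_phaseEquiv, Matrix.mulVec_mulVec, Matrix.mul_nonsing_inv M hM,
    Matrix.one_mulVec]
  rfl

theorem measurePreserving_phaseEquiv (hM' : |M.det| = 1) :
    MeasurePreserving (phaseEquiv M hM) := by
  have h1 : MeasurePreserving (fun x : Fin n → ℝ => M⁻¹.mulVec x) := by
    have hdet : |(M⁻¹).det| = 1 := by
      rw [Matrix.det_nonsing_inv, Ring.inverse_eq_inv', abs_inv, hM', inv_one]
    have h := Real.map_matrix_volume_pi_eq_smul_volume_pi (M := M⁻¹)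
      (fun h => by simp [h] at hdet)
    rw [abs_inv, hdet, inv_one, ENNReal.ofReal_one, one_smul] at h
    exact ⟨(Matrix.toLin' M⁻¹).continuous_of_finiteDimensional.measurable, h⟩
  have h2 : MeasurePreserving (fun y : (Fin n → ℝ) × (Fin n → ℝ) => (y.1, M⁻¹.mulVec y.2)) :=
    (MeasurePreserving.id volume).prod h1
  have h3 := ((volume_measurePreserving_piCongrLeft (fun _ => ℝ) finSumFinEquiv).comp
    (volume_measurePreserving_sumPiEquivProdPi_symm fun _ : Fin n ⊕ Fin n => ℝ)).comp h2
  refine (congrArg (fun f => MeasurePreserving f volume volume) (funext fun y => ?_)).mpr h3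
  ext i
  rw [phaseEquiv_apply]
  refine Fin.addCases (fun j => ?_) (fun j => ?_) i
  · rw [Fin.append_left, ← finSumFinEquiv_apply_left]
    simp only [Function.comp_apply]
    rw [MeasurableEquiv.piCongrLeft_apply_apply]
    rfl
  · rw [Fin.append_right, ← finSumFinEquiv_apply_right]
    simp only [Function.comp_apply]
    rw [MeasurableEquiv.piCongrLeft_apply_apply]
    rfl

theorem integral_comp_phaseEquiv {V : Type*} [NormedAddCommGroup V] [NormedSpace ℝ V]
    (hM' : |M.det| = 1) (F : (Fin (n + n) → ℝ) → V) :
    ∫ z, F z = ∫ y, F (phaseEquiv M hM y) :=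
  ((measurePreserving_phaseEquiv M hM hM').integral_comp
    (phaseEquiv M hM).toHomeomorph.measurableEmbedding F).symm

theorem IsOscInt.unique {V : Type*} [NormedAddCommGroup V] [NormedSpace ℝ V] [NormedSpace ℂ V]
    [IsScalarTower ℝ ℂ V] {M : Matrix (Fin n) (Fin n) ℝ} {F : (Fin (n + n) → ℝ) → V} {v w : V}
    (hv : IsOscInt M F v) (hw : IsOscInt M F w) : v = w := by
  let χ : ContDiffBump (0 : Fin (n + n) → ℝ) := ⟨1, 2, one_pos, one_lt_two⟩
  exact tendsto_nhds_unique
    (hv χ χ.contDiff χ.hasCompactSupport χ.eventuallyEq_one 0)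
    (hw χ χ.contDiff χ.hasCompactSupport χ.eventuallyEq_one 0)

theorem IsOscInt.oscInt_eq {V : Type*} [NormedAddCommGroup V] [NormedSpace ℝ V]
    [NormedSpace ℂ V] [IsScalarTower ℝ ℂ V] {M : Matrix (Fin n) (Fin n) ℝ}
    {F : (Fin (n + n) → ℝ) → V} {v : V} (hv : IsOscInt M F v) : oscInt M F = v := by
  have h : ∃ v, IsOscInt M F v := ⟨v, hv⟩
  rw [oscInt, dif_pos h]
  exact h.choose_spec.unique hv

variable {A : Type*} [NormedAddCommGroup A] [NormedSpace ℂ A] [CompleteSpace A]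
  {α : (Fin n → ℝ) → A →L[ℂ] A}

theorem IsSmoothAction.isOscInt_deform (h : IsSmoothAction α) {C : ℝ} {k : ℕ}
    (hC : ∀ x, ‖α x‖ ≤ C * (1 + ‖x‖) ^ k) (hM' : |M.det| = 1) (θ : Matrix (Fin n) (Fin n) ℝ)
    (K : Bilin A) (a b : A) :
    IsOscInt M (fun z : Fin (n + n) → ℝ => K (α (θ.mulVec (fstHalf z)) a) (α (sndHalf z) b))
      (h.deform θ.mulVecLin M⁻¹.mulVecLin K 1 a b) := by
  intro χ hχ hχc hχ1 z₀
  have hM : IsUnit M.det := isUnit_iff_ne_zero.2 fun h0 => by simp [h0] at hM'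
  set Φ := phaseEquiv M hM with hΦ
  have hψ : IsTest (χ ∘ Φ) := ⟨hχ.comp Φ.contDiff, hχc.comp_homeomorph Φ.toHomeomorph⟩
  have h1 := h.tendsto_integral_pairing θ.mulVecLin M⁻¹.mulVecLin hC K a b (Φ.symm z₀) hψ
  have h0 : (χ ∘ Φ) 0 = 1 := by simpa using hχ1.self_of_nhds
  rw [h0, mul_one] at h1
  have h2 := h1.const_smul (((2 * Real.pi) ^ n)⁻¹)
  rw [smul_smul, inv_mul_cancel₀ (by positivity), one_smul] at h2
  refine h2.congr fun ε => ?_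
  unfold cutInt
  rw [integral_comp_phaseEquiv M hM hM']
  congr 2
  funext y
  simp only [phase_phaseEquiv, fstHalf_phaseEquiv, sndHalf_phaseEquiv, hΦ]
  have : ε • (phaseEquiv M hM y - z₀) =
      phaseEquiv M hM (ε • (y - (phaseEquiv M hM).symm z₀)) := by simp
  rw [this]
  rfl

end ChangeOfVariables

theorem statement16 {n : ℕ} {A : Type*} [NormedAddCommGroup A] [NormedSpace ℝ A]
    [NormedSpace ℂ A] [IsScalarTower ℝ ℂ A] [CompleteSpace A]
    (M : Matrix (Fin n) (Fin n) ℝ) (hM : |M.det| = 1)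
    (mul : A →L[ℂ] A →L[ℂ] A) (C₀ : ℝ) (hC₀ : 0 < C₀)
    (hmulbound : ∀ a b : A, ‖mul a b‖ ≤ C₀ * ‖a‖ * ‖b‖)
    (hassoc : ∀ a b c : A, mul (mul a b) c = mul a (mul b c))
    (m : ℝ) (hm : 0 ≤ m)
    (α : (Fin n → ℝ) → A →L[ℂ] A)
    (hα0 : α 0 = ContinuousLinearMap.id ℂ A)
    (hαadd : ∀ x x' : Fin n → ℝ, α (x + x') = (α x).comp (α x'))
    (hαmul : ∀ (x : Fin n → ℝ) (a b : A), α x (mul a b) = mul (α x a) (α x b))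
    (hαsmooth : ∀ a : A, ContDiff ℝ (⊤ : ℕ∞) (fun x => α x a))
    (hαbound : ∀ μ : Fin n → ℕ, ∃ C : ℝ, 0 < C ∧ ∀ (x : Fin n → ℝ) (a : A),
      ‖mder μ (fun x' => α x' a) x‖ ≤ C * (1 + ‖x‖ ^ 2) ^ (m / 2) * ‖a‖)
    (θ : Matrix (Fin n) (Fin n) ℝ) :
    (∀ a b : A, IsSymbol (2 * m) 0 (fun z : Fin (n + n) → ℝ =>
      mul (α (θ.mulVec (fstHalf z)) a) (α (sndHalf z) b))) ∧
    (∀ a a' b : A, defProd M θ mul α (a + a') b =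
      defProd M θ mul α a b + defProd M θ mul α a' b) ∧
    (∀ (cc : ℂ) (a b : A), defProd M θ mul α (cc • a) b = cc • defProd M θ mul α a b) ∧
    (∀ a b b' : A, defProd M θ mul α a (b + b') =
      defProd M θ mul α a b + defProd M θ mul α a b') ∧
    (∀ (cc : ℂ) (a b : A), defProd M θ mul α a (cc • b) = cc • defProd M θ mul α a b) ∧
    (∃ C : ℝ, 0 < C ∧ ∀ a b : A, ‖defProd M θ mul α a b‖ ≤ C * ‖a‖ * ‖b‖) ∧
    (∀ a b c : A, defProd M θ mul α (defProd M θ mul α a b) c =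
      defProd M θ mul α a (defProd M θ mul α b c)) := by
  obtain rfl : ‹NormedSpace ℝ A› = NormedSpace.complexToReal := by
    ext r x
    exact (IsScalarTower.algebraMap_smul ℂ r x).symm
  have h : IsSmoothAction α := ⟨hα0, hαadd, hαsmooth⟩
  obtain ⟨C, hC0, hC⟩ := hαbound 0
  simp only [mder_zero] at hC
  have hk : ∀ a b, defProd M θ mul α a b = h.deform θ.mulVecLin M⁻¹.mulVecLin mul 1 a b :=
    fun a b => (h.isOscInt_deform M (norm_le_pow_of_rpow hC0.le hC) hM θ mul a b).oscInt_eq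
  simp only [hk]
  refine ⟨fun a b => h.isSymbol_pairing hm hC θ mul a b, by simp, by simp, by simp, by simp, ?_,
    h.deform_assoc _ _ (h.gen_mul hαmul) hassoc 1⟩
  refine ⟨‖h.deform θ.mulVecLin M⁻¹.mulVecLin mul 1‖ + 1, by positivity, fun a b => ?_⟩
  refine (ContinuousLinearMap.le_opNorm₂ _ a b).trans ?_
  gcongr
  linarith
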